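/- arXiv:1411.6954 — 9 statements merged into one kernel-verified Lean document; each statement's English description precedes it below -/
import Mathlib

section
/- Fix integers d > e ≥ 1 and D ≥ 1. There are only finitely many tuples (a_1, …, a_{d−1}, b_1, …, b_{e−1}) ∈ ℂ^{d+e−2} such that every coordinate a_i and b_j is algebraic over ℚ of degree at most D and the correspondence C : y^e + b_{e−1}y^{e−1} + ⋯ + b_1 y = x^d + a_{d−1}x^{d−1} + ⋯ + a_1 x is postcritically constrained. -/
open Polynomial

/-- The polynomial function `x ↦ x^dd + ∑_{i=1}^{m} c_i x^i` (monic of degree `dd`,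
zero constant term), with coefficients `c : Fin m → ℂ` giving `c_i = c ⟨i-1⟩`. -/
noncomputable def fC {m : ℕ} (dd : ℕ) (c : Fin m → ℂ) (x : ℂ) : ℂ :=
  x ^ dd + ∑ i : Fin m, c i * x ^ ((i : ℕ) + 1)

/-- `σ` is a critical point of the correspondence `g(y) = f(x)` with
`f = fC d a`, `g = fC e b`: either `f'(σ) = 0`, or some `τ` with `g(τ) = f(σ)`
has `g'(τ) = 0`. -/
def IsCritPt (d e : ℕ) (a : Fin (d - 1) → ℂ) (b : Fin (e - 1) → ℂ) (σ : ℂ) : Prop :=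
  deriv (fC d a) σ = 0 ∨ ∃ τ : ℂ, fC e b τ = fC d a σ ∧ deriv (fC e b) τ = 0

/-- The correspondence `fC e b (y) = fC d a (x)` is postcritically constrained:
every critical point starts at least one preperiodic path. -/
def IsPCC (d e : ℕ) (a : Fin (d - 1) → ℂ) (b : Fin (e - 1) → ℂ) : Prop :=
  ∀ σ : ℂ, IsCritPt d e a b σ →
    ∃ x : ℕ → ℂ, x 0 = σ ∧ (∀ n, fC e b (x (n + 1)) = fC d a (x n)) ∧
      ∃ m n : ℕ, m < n ∧ ∀ k : ℕ, x (m + k) = x (n + k)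

theorem eq_zero_of_eval_critical_eq_zero {k : Type*} [Field k] {n : ℕ} {f : k[X]}
    (hf : f.Monic) (hdeg : f.natDegree = n) (h0 : f.coeff 0 = 0)
    (hn : ∀ i : ℕ, 1 ≤ i → i ≤ n → (i : k) ≠ 0) {c : Fin (n - 1) → k}
    (hder : derivative f = C (n : k) * ∏ i, (X - C (c i)))
    (hc : ∀ i, f.eval (c i) = 0) (i : Fin (n - 1)) : c i = 0 := by
  classical
  have hnpos : 1 ≤ n := by have := i.2; omega
  have hroots : (derivative f).roots = Finset.univ.val.map c := by
    rw [hder, roots_C_mul _ (hn n hnpos le_rfl)]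
    have hprod : ∏ i, (X - C (c i)) =
        ((Finset.univ.val.map c).map fun s => X - C s).prod := by
      rw [Multiset.map_map]; rfl
    rw [hprod, roots_multiset_prod_X_sub_C]
  set T : Finset k := insert 0 (Finset.univ.image c) with hT
  have hroot : ∀ s ∈ T, f.IsRoot s := by
    intro s hs
    rcases Finset.mem_insert.1 hs with rfl | hs
    · rwa [IsRoot, ← coeff_zero_eq_eval_zero]
    · obtain ⟨j, -, rfl⟩ := Finset.mem_image.1 hs
      exact hc j
  have hmult : ∀ s ∈ T, f.rootMultiplicity s = (derivative f).rootMultiplicity s + 1 := by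
    intro s hs
    have hpos : 0 < f.rootMultiplicity s := (rootMultiplicity_pos hf.ne_zero).2 (hroot s hs)
    have hle : f.rootMultiplicity s ≤ n := by
      rw [← hdeg, ← count_roots]
      exact (Multiset.count_le_card _ _).trans (card_roots' f)
    rw [derivative_rootMultiplicity_of_root_of_mem_nonZeroDivisors (hroot s hs)
      (mem_nonZeroDivisors_of_ne_zero (hn _ hpos hle))]
    omega
  have h1 : ∑ s ∈ T, f.rootMultiplicity s ≤ n := by
    calc ∑ s ∈ T, f.rootMultiplicity s = ∑ s ∈ T, f.roots.count s := by simp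
      _ ≤ ∑ s ∈ f.roots.toFinset, f.roots.count s := by
          refine Finset.sum_le_sum_of_subset fun s hs => ?_
          rw [Multiset.mem_toFinset, mem_roots hf.ne_zero]
          exact hroot s hs
      _ = f.roots.card := Multiset.toFinset_sum_count_eq _
      _ ≤ n := hdeg ▸ card_roots' f
  have h2 : ∑ s ∈ T, (derivative f).rootMultiplicity s = n - 1 := by
    calc ∑ s ∈ T, (derivative f).rootMultiplicity s
        = ∑ s ∈ T, (derivative f).roots.count s := by simp
      _ = (derivative f).roots.card := by
          refine Multiset.sum_count_eq_card fun s hs => ?_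
          rw [hroots] at hs
          simp only [Multiset.mem_map] at hs
          obtain ⟨j, -, rfl⟩ := hs
          simp [hT]
      _ = n - 1 := by simp [hroots]
  rw [Finset.sum_congr rfl hmult, Finset.sum_add_distrib, h2] at h1
  have hcard : T.card ≤ 1 := by simp at h1; omega
  exact Finset.card_le_one.1 hcard _ (by simp [hT]) _ (by simp [hT])

theorem coeff_mem_of_derivative_eq_prod {K : Type*} [Field K] (O : ValuationSubring K)
    {n : ℕ} {f : K[X]} (hdeg : f.natDegree ≤ n) (h0 : f.coeff 0 = 0)
    (hn : ∀ i : ℕ, 1 ≤ i → i ≤ n → (i : K) ≠ 0 ∧ (i : K)⁻¹ ∈ O) {c : Fin (n - 1) → K}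
    (hder : derivative f = C (n : K) * ∏ i, (X - C (c i)))
    (hc : ∀ i, c i ∈ O) (m : ℕ) : f.coeff m ∈ O := by
  rcases m with _ | m
  · simp [h0, zero_mem]
  by_cases hm : m + 1 ≤ n
  swap
  · rw [coeff_eq_zero_of_natDegree_lt (by omega)]; exact zero_mem _
  have h1 : (derivative f).coeff m ∈ O := by
    have : derivative f = (C (n : O) * ∏ i, (X - C (⟨c i, hc i⟩ : O))).map
        (algebraMap O K) := by
      rw [hder]
      simp only [Polynomial.map_mul, Polynomial.map_prod, Polynomial.map_sub, map_X, map_C]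
      simp
    rw [this, coeff_map]
    exact Subtype.prop _
  rw [coeff_derivative] at h1
  obtain ⟨hne, hinv⟩ := hn (m + 1) (by omega) hm
  have := mul_mem h1 hinv
  push_cast at this hne
  rwa [mul_assoc, mul_inv_cancel₀ hne, mul_one] at this

theorem eq_X_pow_of_derivative_eq {k : Type*} [Field k] {n : ℕ} {f : k[X]}
    (hf : f.Monic) (hdeg : f.natDegree = n) (h0 : f.coeff 0 = 0)
    (hn : ∀ i : ℕ, 1 ≤ i → i ≤ n → (i : k) ≠ 0)
    (hder : derivative f = C (n : k) * X ^ (n - 1)) : f = X ^ n := by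
  ext m
  rw [coeff_X_pow]
  split_ifs with hm
  · rw [hm, ← hdeg]; exact hf
  rcases m with _ | m
  · exact h0
  by_cases hmn : m + 1 ≤ n
  swap
  · exact coeff_eq_zero_of_natDegree_lt (by omega)
  have h1 := congrArg (fun q => q.coeff m) hder
  simp only [coeff_derivative, coeff_C_mul, coeff_X_pow, if_neg (show m ≠ n - 1 by omega),
    mul_zero] at h1
  have := hn (m + 1) (by omega) hmn
  push_cast at this
  exact (mul_eq_zero.1 h1).resolve_right this

/-- A witness, relative to a set `S` of scalars, that the correspondence `g(y) = u f(x)` has a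
path of length two from `x₀` whose members are all dominated by some point `z` which has an
image `w` that it also dominates. -/
def HasDominatedPath {K : Type*} [Field K] (S : Set K) (f g : K[X]) (u x₀ : K) : Prop :=
  ∃ x₁ x₂ z w : K, g.eval x₁ = u * f.eval x₀ ∧ g.eval x₂ = u * f.eval x₁ ∧
    g.eval w = u * f.eval z ∧ (∃ r ∈ S, x₀ = r * z) ∧ (∃ r ∈ S, x₁ = r * z) ∧
    (∃ r ∈ S, x₂ = r * z) ∧ (∃ r ∈ S, w = r * z)

theorem eval_map_subtype {K : Type*} [Field K] (O : ValuationSubring K) (f : O[X]) (x : O) :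
    (f.map (algebraMap O K)).eval (x : K) = (f.eval x : O) :=
  eval_map_apply (algebraMap O K) x

theorem dominatedPath_mem {K : Type*} [Field K] (O : ValuationSubring K) {f g : O[X]}
    (hf : f.Monic) (hdeg : g.natDegree < f.natDegree)
    {p : O} (hp0 : p ≠ 0) (hp : p ∈ IsLocalRing.maximalIdeal O) {z w : K}
    (hw : (g.map (algebraMap O K)).eval w = (p : K)⁻¹ * (f.map (algebraMap O K)).eval z)
    (hwz : ∃ r ∈ O, w = r * z) : z ∈ O := by
  by_contra hz
  have hz0 : z ≠ 0 := fun h => hz (h ▸ zero_mem O)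
  obtain ⟨r, hr, rfl⟩ := hwz
  have hzinv : z⁻¹ ∈ O := (O.mem_or_inv_mem z).resolve_left hz
  set ζ : O := ⟨z⁻¹, hzinv⟩ with hζ
  have hζm : ζ ∈ IsLocalRing.maximalIdeal O := by
    rw [IsLocalRing.mem_maximalIdeal, mem_nonunits_iff]
    rintro h
    obtain ⟨y, hy⟩ := h.exists_right_inv
    have : z = y := (inv_mul_eq_one₀ hz0).1 (congrArg Subtype.val hy)
    exact hz (this ▸ y.2)
  have key : ∀ (q : O[X]) (s : O),
      (((scaleRoots q ζ).eval s : O) : K) =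
        (z⁻¹) ^ q.natDegree * (q.map (algebraMap O K)).eval (s * z) := by
    intro q s
    have h := scaleRoots_eval₂_mul (p := q) (algebraMap O K) (s * z : K) ζ
    have h2 : (algebraMap O K ζ) * (s * z : K) = algebraMap O K s := by
      change z⁻¹ * (s * z : K) = s
      field_simp
    rw [h2, eval₂_at_apply] at h
    rw [eval_map]
    exact h
  have hf1 := key f 1
  have hg1 := key g ⟨r, hr⟩
  have heq : (scaleRoots f ζ).eval 1 =
      p * ζ ^ (f.natDegree - g.natDegree) * (scaleRoots g ζ).eval ⟨r, hr⟩ := by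
    apply Subtype.val_injective
    push_cast
    rw [hf1, hg1, hw]
    have hp' : (p : K) ≠ 0 := by simpa using hp0
    have : (z⁻¹) ^ f.natDegree = (z⁻¹) ^ (f.natDegree - g.natDegree) * (z⁻¹) ^ g.natDegree := by
      rw [← pow_add]; congr 1; omega
    rw [this]
    simp only [hζ, OneMemClass.coe_one, one_mul]
    field_simp
  have hmem : (scaleRoots f ζ).eval 1 ∈ IsLocalRing.maximalIdeal O := by
    rw [heq, mul_assoc]; exact Ideal.mul_mem_right _ _ hp
  have hres := (IsLocalRing.residue_eq_zero_iff _).2 hmem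
  rw [← eval_map_apply, map_scaleRoots _ _ _ (by simp [hf.leadingCoeff]),
    (IsLocalRing.residue_eq_zero_iff _).2 hζm, scaleRoots_zero] at hres
  simp [(hf.map _).leadingCoeff] at hres

theorem residue_critical_eq_zero {K : Type*} [Field K] (O : ValuationSubring K) {d e : ℕ}
    (hde : e < d) {f g : O[X]} (hf : f.Monic) (hg : g.Monic) (hfd : f.natDegree = d)
    (hge : g.natDegree = e) (hf0 : f.coeff 0 = 0) (hg0 : g.coeff 0 = 0)
    (hn : ∀ i : ℕ, 1 ≤ i → i ≤ d → (i : IsLocalRing.ResidueField O) ≠ 0)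
    {c : Fin (d - 1) → O} {t : Fin (e - 1) → O}
    (hfc : derivative f = C (d : O) * ∏ i, (X - C (c i)))
    (hgt : derivative g = C (e : O) * ∏ i, (X - C (t i)))
    {p : O} (hp0 : p ≠ 0) (hp : p ∈ IsLocalRing.maximalIdeal O)
    (hc : ∀ i, HasDominatedPath (O : Set K) (f.map (algebraMap O K)) (g.map (algebraMap O K))
      (p : K)⁻¹ (c i))
    (ht : ∀ i, ∃ s : K, (g.eval (t i) : O) = (p : K)⁻¹ * (f.map (algebraMap O K)).eval s ∧
      HasDominatedPath (O : Set K) (f.map (algebraMap O K)) (g.map (algebraMap O K)) (p : K)⁻¹ s) :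
    (∀ i, c i ∈ IsLocalRing.maximalIdeal O) ∧ ∀ i, t i ∈ IsLocalRing.maximalIdeal O := by
  have hpK : (p : K) ≠ 0 := by simpa using hp0
  have step : ∀ x y : O, ((g.eval y : O) : K) = (p : K)⁻¹ * (f.eval x : O) →
      (f.map (IsLocalRing.residue O)).eval (IsLocalRing.residue O x) = 0 := by
    intro x y h
    rw [eval_map_apply, IsLocalRing.residue_eq_zero_iff]
    have : f.eval x = p * g.eval y := by
      apply Subtype.val_injective
      push_cast
      rw [h]; field_simp
    rw [this]; exact Ideal.mul_mem_right _ _ hp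
  have path : ∀ s : K, HasDominatedPath (O : Set K) (f.map (algebraMap O K))
      (g.map (algebraMap O K)) (p : K)⁻¹ s → ∃ x₀ x₁ : O, s = x₀ ∧
        ((g.eval x₁ : O) : K) = (p : K)⁻¹ * (f.eval x₀ : O) ∧
        (f.map (IsLocalRing.residue O)).eval (IsLocalRing.residue O x₀) = 0 ∧
        (f.map (IsLocalRing.residue O)).eval (IsLocalRing.residue O x₁) = 0 := by
    rintro s ⟨x₁, x₂, z, w, h1, h2, h3, ⟨r₀, hr₀, rfl⟩, ⟨r₁, hr₁, rfl⟩, ⟨r₂, hr₂, rfl⟩, hwz⟩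
    have hz : z ∈ O := dominatedPath_mem O hf (by omega) hp0 hp h3 hwz
    refine ⟨⟨r₀, hr₀⟩ * ⟨z, hz⟩, ⟨r₁, hr₁⟩ * ⟨z, hz⟩, rfl, ?_, ?_, ?_⟩
    · rw [← eval_map_subtype, ← eval_map_subtype]; exact h1
    · refine step _ (⟨r₁, hr₁⟩ * ⟨z, hz⟩) ?_
      rw [← eval_map_subtype, ← eval_map_subtype]; exact h1
    · refine step _ (⟨r₂, hr₂⟩ * ⟨z, hz⟩) ?_
      rw [← eval_map_subtype, ← eval_map_subtype]; exact h2
  have der : ∀ {m : ℕ} {q : O[X]} {s : Fin (m - 1) → O},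
      derivative q = C (m : O) * ∏ i, (X - C (s i)) →
      derivative (q.map (IsLocalRing.residue O)) = C (m : IsLocalRing.ResidueField O) *
        ∏ i, (X - C (IsLocalRing.residue O (s i))) := by
    intro m q s h
    rw [derivative_map, h]
    simp [Polynomial.map_prod]
  have hcz : ∀ i, IsLocalRing.residue O (c i) = 0 := by
    refine eq_zero_of_eval_critical_eq_zero (hf.map _) ?_ ?_ hn (der hfc) fun i => ?_
    · rw [hf.natDegree_map, hfd]
    · rw [coeff_map, hf0, map_zero]
    · obtain ⟨x₀, x₁, h0, -, h1, -⟩ := path _ (hc i)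
      rwa [Subtype.val_injective h0]
  refine ⟨fun i => (IsLocalRing.residue_eq_zero_iff _).1 (hcz i), fun i =>
    (IsLocalRing.residue_eq_zero_iff _).1 ?_⟩
  refine eq_zero_of_eval_critical_eq_zero (hg.map _) ?_ ?_ (fun i h1 h2 => hn i h1 (by omega))
    (der hgt) (fun i => ?_) i
  · rw [hg.natDegree_map, hge]
  · rw [coeff_map, hg0, map_zero]
  · obtain ⟨s, hs, hpath⟩ := ht i
    obtain ⟨x₀, x₁, h0, hx, -, h1⟩ := path _ hpath
    have hx₁ : g.eval (t i) = g.eval x₁ := by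
      apply Subtype.val_injective
      rw [hs, hx, h0, eval_map_subtype]
    have hx0 : IsLocalRing.residue O x₁ = 0 := by
      rw [eq_X_pow_of_derivative_eq (hf.map _) (by rw [hf.natDegree_map, hfd])
        (by rw [coeff_map, hf0, map_zero]) hn (by simpa [hcz] using der hfc)] at h1
      exact eq_zero_of_pow_eq_zero (by simpa using h1)
    rw [eval_map_apply, hx₁, ← eval_map_apply, hx0, ← coeff_zero_eq_eval_zero, coeff_map, hg0,
      map_zero]

theorem exists_integral_rescaling {K : Type*} [Field K] (O : ValuationSubring K)
    {n : ℕ} (hn0 : 1 ≤ n) {f : K[X]} (hf : f.Monic) (hdeg : f.natDegree = n) (h0 : f.coeff 0 = 0)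
    (hn : ∀ i : ℕ, 1 ≤ i → i ≤ n → (i : K) ≠ 0 ∧ (i : K)⁻¹ ∈ O) {c : Fin (n - 1) → K}
    (hder : derivative f = C (n : K) * ∏ i, (X - C (c i))) {t : K} (ht : t ≠ 0)
    (s : Fin (n - 1) → O) (hs : ∀ i, c i = s i * t) :
    ∃ F : O[X], F.Monic ∧ F.natDegree = n ∧ F.coeff 0 = 0 ∧
      derivative F = C (n : O) * ∏ i, (X - C (s i)) ∧
      ∀ x, (F.map (algebraMap O K)).eval x = t⁻¹ ^ n * f.eval (x * t) := by
  set q : K[X] := C (t⁻¹ ^ n) * f.comp (C t * X) with hq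
  have hcoeff : ∀ m, q.coeff m = t⁻¹ ^ n * (f.coeff m * t ^ m) := fun m => by
    rw [hq, coeff_C_mul, comp_C_mul_X_coeff]
  have hqn : q.coeff n = 1 := by
    rw [hcoeff, ← hdeg, hf.coeff_natDegree, one_mul, ← mul_pow, inv_mul_cancel₀ ht, one_pow]
  have hqle : q.natDegree ≤ n := by
    refine natDegree_le_iff_coeff_eq_zero.2 fun m hm => ?_
    rw [hcoeff, coeff_eq_zero_of_natDegree_lt (by omega), zero_mul, mul_zero]
  have hqdeg : q.natDegree = n :=
    le_antisymm hqle (le_natDegree_of_ne_zero (by rw [hqn]; exact one_ne_zero))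
  have hqm : q.Monic := by rw [Monic, leadingCoeff, hqdeg, hqn]
  have hq0 : q.coeff 0 = 0 := by rw [hcoeff, h0, zero_mul, mul_zero]
  have hqder : derivative q = C (n : K) * ∏ i, (X - C (s i : K)) := by
    rw [hq, derivative_C_mul, derivative_comp, hder]
    simp only [mul_comp, prod_comp, sub_comp, X_comp, C_comp, derivative_C_mul, derivative_X,
      mul_one, hs, C_mul]
    have : ∀ i, C t * X - C (s i : K) * C t = C t * (X - C (s i : K)) := fun i => by ring
    simp only [this, Finset.prod_mul_distrib, Finset.prod_const, Finset.card_univ,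
      Fintype.card_fin]
    obtain ⟨k, rfl⟩ : ∃ k, n = k + 1 := ⟨n - 1, by omega⟩
    have h1 : (C (t⁻¹ ^ (k + 1)) * C t * C t ^ k : K[X]) = 1 := by
      rw [← C_pow, ← C_mul, ← C_mul, mul_assoc, ← pow_succ', ← mul_pow, inv_mul_cancel₀ ht,
        one_pow, C_1]
    calc _ = (C (t⁻¹ ^ (k + 1)) * C t * C t ^ k : K[X]) *
        (C ((k + 1 : ℕ) : K) * ∏ i, (X - C (s i : K))) := by simp only [Nat.add_sub_cancel]; ring
      _ = _ := by rw [h1, one_mul]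
  have hqO := coeff_mem_of_derivative_eq_prod O hqle hq0 hn hqder (fun i => (s i).2)
  have hlift : q ∈ lifts (algebraMap O K) :=
    (lifts_iff_coeff_lifts _).2 fun m => ⟨⟨_, hqO m⟩, rfl⟩
  obtain ⟨F, hF, hFd, hFm⟩ := lifts_and_natDegree_eq_and_monic hlift hqm
  have hinj : Function.Injective (algebraMap O K) := Subtype.val_injective
  refine ⟨F, hFm, hFd.trans hqdeg, hinj ?_, map_injective _ hinj ?_, fun x => ?_⟩
  · rw [← coeff_map, hF, hq0, map_zero]
  · rw [← derivative_map, hF, hqder]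
    simp only [Polynomial.map_mul, Polynomial.map_prod, Polynomial.map_sub, map_X, map_C, map_natCast,
      Polynomial.map_natCast]
    rfl
  · rw [hF, hq, eval_mul, eval_C, eval_comp, eval_mul, eval_C, eval_X, mul_comm t x]

theorem critical_mem {K : Type*} [Field K] (O : ValuationSubring K) {d e : ℕ} (he : 1 ≤ e)
    (hde : e < d) {f g : K[X]} (hf : f.Monic) (hg : g.Monic) (hfd : f.natDegree = d)
    (hge : g.natDegree = e) (hf0 : f.coeff 0 = 0) (hg0 : g.coeff 0 = 0)
    (hn : ∀ i : ℕ, 1 ≤ i → i ≤ d → (i : K) ≠ 0 ∧ (i : K)⁻¹ ∈ O)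
    {c : Fin (d - 1) → K} {t : Fin (e - 1) → K}
    (hfc : derivative f = C (d : K) * ∏ i, (X - C (c i)))
    (hgt : derivative g = C (e : K) * ∏ i, (X - C (t i)))
    (hc : ∀ i, HasDominatedPath (O : Set K) f g 1 (c i))
    (ht : ∀ i, ∃ s : K, g.eval (t i) = f.eval s ∧ HasDominatedPath (O : Set K) f g 1 s) :
    (∀ i, c i ∈ O) ∧ ∀ i, t i ∈ O := by
  have hnk : ∀ i : ℕ, 1 ≤ i → i ≤ d → (i : IsLocalRing.ResidueField O) ≠ 0 := by
    intro i h1 h2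
    obtain ⟨hne, hinv⟩ := hn i h1 h2
    have hu : IsUnit (i : O) := by
      refine IsUnit.of_mul_eq_one ⟨_, hinv⟩ (Subtype.val_injective ?_)
      push_cast
      exact mul_inv_cancel₀ hne
    simpa using (hu.map (IsLocalRing.residue O)).ne_zero
  set x : Fin (d - 1) ⊕ Fin (e - 1) → K := Sum.elim c t with hx
  suffices h : ∀ j, x j ∈ O from ⟨fun i => h (.inl i), fun i => h (.inr i)⟩
  by_contra! hcon
  obtain ⟨j, hj⟩ := hcon
  have : Nonempty (Fin (d - 1) ⊕ Fin (e - 1)) := ⟨j⟩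
  obtain ⟨m, hm⟩ := Finite.exists_max fun i => O.valuation (x i)
  set y := x m with hy
  have hyO : y ∉ O := fun h => hj <| (O.valuation_le_one_iff _).1 <|
    (hm j).trans ((O.valuation_le_one_iff _).2 h)
  have hy0 : y ≠ 0 := fun h => hyO (h ▸ zero_mem O)
  have hyinv : y⁻¹ ∈ O := (O.mem_or_inv_mem y).resolve_left hyO
  have hdiv : ∀ i, x i * y⁻¹ ∈ O := fun i => by
    rw [← O.valuation_le_one_iff, map_mul, map_inv₀]
    exact mul_inv_le_one_of_le₀ (hm i) zero_le
  set u : O := ⟨y⁻¹, hyinv⟩ with hu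
  have hu0 : u ≠ 0 := fun h => inv_ne_zero hy0 (congrArg Subtype.val h)
  have hum : u ∈ IsLocalRing.maximalIdeal O := by
    rw [IsLocalRing.mem_maximalIdeal, mem_nonunits_iff]
    intro h
    obtain ⟨z, hz⟩ := h.exists_right_inv
    have : y = z := (inv_mul_eq_one₀ hy0).1 (congrArg Subtype.val hz)
    exact hyO (this ▸ z.2)
  obtain ⟨F, hFm, hFd, hF0, hFder, hFe⟩ := exists_integral_rescaling O (by omega) hf hfd hf0 hn hfc
    hy0 (fun i => ⟨x (.inl i) * y⁻¹, hdiv _⟩) (fun i => by simp [hx, hy0])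
  obtain ⟨G, hGm, hGd, hG0, hGder, hGe⟩ := exists_integral_rescaling O he hg hge hg0
    (fun i h1 h2 => hn i h1 (by omega)) hgt
    hy0 (fun i => ⟨x (.inr i) * y⁻¹, hdiv _⟩) (fun i => by simp [hx, hy0])
  have hp : ((u ^ (d - e) : O) : K)⁻¹ = y ^ (d - e) := by simp [hu]
  have hpow : y⁻¹ ^ e = y ^ (d - e) * y⁻¹ ^ d := by
    have : y⁻¹ ^ d = y⁻¹ ^ (d - e) * y⁻¹ ^ e := by rw [← pow_add, Nat.sub_add_cancel hde.le]
    rw [this, ← mul_assoc, ← mul_pow, mul_inv_cancel₀ hy0, one_pow, one_mul]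
  have hcor : ∀ a b : K, g.eval b = f.eval a →
      (G.map (algebraMap O K)).eval (b * y⁻¹) =
        ((u ^ (d - e) : O) : K)⁻¹ * (F.map (algebraMap O K)).eval (a * y⁻¹) := by
    intro a b h
    rw [hGe, hFe, hp, inv_mul_cancel_right₀ hy0, inv_mul_cancel_right₀ hy0, h, hpow]
    ring
  have hpath : ∀ a, HasDominatedPath (O : Set K) f g 1 a →
      HasDominatedPath (O : Set K) (F.map (algebraMap O K)) (G.map (algebraMap O K))
        ((u ^ (d - e) : O) : K)⁻¹ (a * y⁻¹) := by
    rintro a ⟨x₁, x₂, z, w, h1, h2, h3, ⟨r₀, hr₀, rfl⟩, ⟨r₁, hr₁, rfl⟩, ⟨r₂, hr₂, rfl⟩,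
      ⟨r₃, hr₃, rfl⟩⟩
    rw [one_mul] at h1 h2 h3
    exact ⟨_, _, z * y⁻¹, _, hcor _ _ h1, hcor _ _ h2, hcor _ _ h3, ⟨r₀, hr₀, mul_assoc ..⟩,
      ⟨r₁, hr₁, mul_assoc ..⟩, ⟨r₂, hr₂, mul_assoc ..⟩, ⟨r₃, hr₃, mul_assoc ..⟩⟩
  obtain ⟨h1, h2⟩ := residue_critical_eq_zero O hde hFm hGm hFd hGd hF0 hG0 hnk hFder hGder
    (pow_ne_zero (d - e) hu0) (Ideal.pow_mem_of_mem _ hum _ (by omega)) (fun i => hpath _ (hc i))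
    (fun i => by
      obtain ⟨s, hs, hsp⟩ := ht i
      refine ⟨s * y⁻¹, ?_, hpath s hsp⟩
      rw [← hcor _ _ hs, ← eval_map_subtype]
      rfl)
  have hmem : (⟨x m * y⁻¹, hdiv m⟩ : O) ∈ IsLocalRing.maximalIdeal O := by
    rcases m with i | i
    · exact h1 i
    · exact h2 i
  have hone : (⟨x m * y⁻¹, hdiv m⟩ : O) = 1 := Subtype.val_injective (mul_inv_cancel₀ hy0)
  rw [hone] at hmem
  exact (Ideal.ne_top_iff_one _).1 (IsLocalRing.maximalIdeal.isMaximal O).ne_top hmem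

/-- The polynomial `X ^ n + ∑ c_i X ^ (i + 1)`, the sum running over `i < n - 1`. -/
noncomputable def monicPoly {R : Type*} [CommRing R] (n : ℕ) (c : Fin (n - 1) → R) : R[X] :=
  X ^ n + ∑ i, C (c i) * X ^ ((i : ℕ) + 1)

section monicPoly

variable {R S : Type*} [CommRing R] [CommRing S] {n : ℕ} (c : Fin (n - 1) → R)

theorem eval_monicPoly (x : R) :
    (monicPoly n c).eval x = x ^ n + ∑ i, c i * x ^ ((i : ℕ) + 1) := by
  simp [monicPoly, eval_finsetSum]

theorem map_monicPoly (φ : R →+* S) :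
    (monicPoly n c).map φ = monicPoly n fun i => φ (c i) := by
  simp [monicPoly, Polynomial.map_sum]

theorem degree_monicPoly_aux (hn : 1 ≤ n) :
    (∑ i, C (c i) * X ^ ((i : ℕ) + 1) : R[X]).degree < (n : WithBot ℕ) := by
  refine (degree_sum_le _ _).trans_lt ((Finset.sup_lt_iff (WithBot.bot_lt_coe n)).2 fun i _ => ?_)
  refine (degree_C_mul_X_pow_le _ _).trans_lt ?_
  have := i.2
  exact WithBot.coe_lt_coe.2 (by omega : (i : ℕ) + 1 < n)

theorem monic_monicPoly (hn : 1 ≤ n) : (monicPoly n c).Monic :=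
  monic_X_pow_add (degree_monicPoly_aux c hn)

theorem natDegree_monicPoly [Nontrivial R] (hn : 1 ≤ n) : (monicPoly n c).natDegree = n := by
  rw [monicPoly, natDegree_add_eq_left_of_degree_lt, natDegree_X_pow]
  rw [degree_X_pow]
  exact degree_monicPoly_aux c hn

theorem coeff_monicPoly_zero (hn : 1 ≤ n) : (monicPoly n c).coeff 0 = 0 := by
  rw [coeff_zero_eq_eval_zero, eval_monicPoly]
  simp [show n ≠ 0 by omega]

theorem coeff_monicPoly_succ (i : Fin (n - 1)) : (monicPoly n c).coeff (i + 1) = c i := by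
  have := i.2
  simp only [monicPoly, coeff_add, coeff_X_pow, finsetSum_coeff, coeff_C_mul]
  rw [if_neg (by omega), zero_add, Finset.sum_eq_single i]
  · simp
  · intro j _ hj
    rw [if_neg (fun h => hj (Fin.ext (by omega))), mul_zero]
  · simp

end monicPoly

theorem fC_eq_eval {n : ℕ} (c : Fin (n - 1) → ℂ) (x : ℂ) :
    fC n c x = (monicPoly n c).eval x := by
  rw [eval_monicPoly, fC]

theorem deriv_fC {n : ℕ} (c : Fin (n - 1) → ℂ) (x : ℂ) :
    deriv (fC n c) x = (derivative (monicPoly n c)).eval x := by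
  rw [← Polynomial.deriv]
  exact congrArg (fun h => deriv h x) (funext (fC_eq_eval c))

theorem exists_derivative_monicPoly {k : Type*} [Field k] [IsAlgClosed k] [CharZero k] {n : ℕ}
    (hn : 1 ≤ n) (c : Fin (n - 1) → k) :
    ∃ s : Fin (n - 1) → k, derivative (monicPoly n c) = C (n : k) * ∏ i, (X - C (s i)) := by
  set f := monicPoly n c
  have hsp := IsAlgClosed.splits (derivative f)
  have hfn : f.natDegree = n := natDegree_monicPoly c hn
  have hdeg : (derivative f).natDegree = n - 1 := by rw [natDegree_derivative, hfn]
  have hlead : (derivative f).leadingCoeff = n := by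
    rw [leadingCoeff, hdeg, coeff_derivative, Nat.sub_add_cancel hn, ← hfn,
      (monic_monicPoly c hn).coeff_natDegree, one_mul, ← Nat.cast_succ, hfn, Nat.succ_eq_add_one,
      Nat.sub_add_cancel hn]
  have hcard : (derivative f).roots.toList.length = n - 1 := by
    rw [Multiset.length_toList, ← hsp.natDegree_eq_card_roots, hdeg]
  refine ⟨fun i => (derivative f).roots.toList.get (i.cast hcard.symm), ?_⟩
  conv_lhs => rw [hsp.eq_prod_roots, hlead, ← Multiset.coe_toList (derivative f).roots]
  rw [Multiset.map_coe, Multiset.prod_coe]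
  congr 1
  rw [← List.prod_ofFn]
  congr 1
  refine List.ext_get (by simp [hcard]) ?_
  simp

/-- A multiplicative map from `ℂ` to an ordered group with zero which satisfies the triangle
inequality and bounds the inverses of `1, …, d` up to a constant `Q`; this covers both the
valuations of `ℂ` and the absolute values coming from field embeddings `ℂ → ℂ`. -/
structure QuasiAbs (d : ℕ) where
  /-- the value group -/
  Γ : Type
  /-- the order and the multiplication of the value group -/
  [inst : LinearOrderedCommGroupWithZero Γ]
  /-- the map itself -/
  v : ℂ →*₀ Γ
  /-- the constant -/
  Q : Γ
  one_le_Q : 1 ≤ Q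
  map_add_le : ∀ x y, v (x + y) ≤ Q * max (v x) (v y)
  v_neg : ∀ x, v (-x) = v x
  one_le_mul_natCast : ∀ n : ℕ, 1 ≤ n → n ≤ d → 1 ≤ Q * v n

attribute [instance] QuasiAbs.inst

namespace QuasiAbs

variable {d : ℕ}

theorem exists_eq_mul_of_le (V : QuasiAbs d) {x z : ℂ} (h : V.v x ≤ V.v z) :
    ∃ r ∈ {r | V.v r ≤ 1}, x = r * z := by
  rcases eq_or_ne z 0 with rfl | hz
  · rw [map_zero, le_zero_iff, map_eq_zero] at h
    exact ⟨0, by simp, by simp [h]⟩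
  · refine ⟨x / z, ?_, (div_mul_cancel₀ x hz).symm⟩
    rw [Set.mem_ofPred_eq, map_div₀]
    exact div_le_one_of_le₀ h zero_le

theorem hasDominatedPath (V : QuasiAbs d) {e : ℕ} {a : Fin (d - 1) → ℂ} {b : Fin (e - 1) → ℂ}
    (h : IsPCC d e a b) {σ : ℂ} (hσ : IsCritPt d e a b σ) :
    HasDominatedPath {r | V.v r ≤ 1} (monicPoly d a) (monicPoly e b) 1 σ := by
  obtain ⟨x, rfl, hx, m, n, hmn, hper⟩ := h σ hσ
  have hfin : ∀ k, ∃ j < n, x k = x j := by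
    intro k
    induction k using Nat.strong_induction_on with
    | _ k ih =>
      by_cases hk : k < n
      · exact ⟨k, hk, rfl⟩
      · obtain ⟨j, hj, hkj⟩ := ih (m + (k - n)) (by omega)
        refine ⟨j, hj, ?_⟩
        rw [← hkj, hper, Nat.add_sub_cancel' (not_lt.1 hk)]
  obtain ⟨N, -, hN⟩ := Finset.exists_max_image (Finset.range n) (fun k => V.v (x k))
    ⟨0, Finset.mem_range.2 (by omega)⟩
  have hmax : ∀ k, V.v (x k) ≤ V.v (x N) := fun k => by
    obtain ⟨j, hj, hkj⟩ := hfin k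
    rw [hkj]
    exact hN j (Finset.mem_range.2 hj)
  have hstep : ∀ k, (monicPoly e b).eval (x (k + 1)) = 1 * (monicPoly d a).eval (x k) := fun k => by
    rw [one_mul, ← fC_eq_eval, ← fC_eq_eval, hx]
  exact ⟨x 1, x 2, x N, x (N + 1), hstep 0, hstep 1, hstep N, V.exists_eq_mul_of_le (hmax 0),
    V.exists_eq_mul_of_le (hmax 1), V.exists_eq_mul_of_le (hmax 2),
    V.exists_eq_mul_of_le (hmax (N + 1))⟩

end QuasiAbs

/-- An ultrapower of `ℂ`. -/
abbrev UltraComplex : Type := (Filter.hyperfilter ℕ : Filter ℕ).Germ ℂ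

/-- The class in the ultrapower of a sequence of complex numbers. -/
noncomputable def UltraComplex.of : (ℕ → ℂ) →+* UltraComplex :=
  Filter.Germ.coeRingHom _

/-- The valuation ring of the ultrapower given by the sequences that are bounded by a power of the
constants of a sequence of quasi-absolute values. -/
def QuasiAbs.boundedSubring {d : ℕ} (V : ℕ → QuasiAbs d) : ValuationSubring UltraComplex where
  carrier := {x | ∃ f : ℕ → ℂ, UltraComplex.of f = x ∧
    ∃ k : ℕ, ∀ᶠ m in Filter.hyperfilter ℕ, (V m).v (f m) ≤ (V m).Q ^ k}
  mul_mem' := by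
    rintro _ _ ⟨f, rfl, k, hk⟩ ⟨g, rfl, l, hl⟩
    refine ⟨f * g, map_mul .., k + l, ?_⟩
    filter_upwards [hk, hl] with m h1 h2
    rw [Pi.mul_apply, map_mul, pow_add]
    exact mul_le_mul' h1 h2
  one_mem' := ⟨1, map_one _, 0, by simp⟩
  zero_mem' := ⟨0, map_zero _, 0, by simp⟩
  add_mem' := by
    rintro _ _ ⟨f, rfl, k, hk⟩ ⟨g, rfl, l, hl⟩
    refine ⟨f + g, map_add .., max k l + 1, ?_⟩
    filter_upwards [hk, hl] with m h1 h2
    rw [Pi.add_apply, pow_succ']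
    refine ((V m).map_add_le _ _).trans (mul_le_mul_right (max_le ?_ ?_) _)
    · exact h1.trans (pow_le_pow_right₀ (V m).one_le_Q (le_max_left ..))
    · exact h2.trans (pow_le_pow_right₀ (V m).one_le_Q (le_max_right ..))
  neg_mem' := by
    rintro _ ⟨f, rfl, k, hk⟩
    refine ⟨-f, map_neg .., k, ?_⟩
    filter_upwards [hk] with m h1
    rwa [Pi.neg_apply, (V m).v_neg]
  mem_or_inv_mem' := by
    intro x
    induction x using Filter.Germ.inductionOn with | _ f => ?_
    by_cases h : ∀ᶠ m in Filter.hyperfilter ℕ, (V m).v (f m) ≤ (V m).Q ^ 0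
    · exact .inl ⟨f, rfl, 0, h⟩
    · refine .inr ⟨f⁻¹, rfl, 0, ?_⟩
      filter_upwards [Ultrafilter.eventually_not.2 h] with m hm
      rw [pow_zero, not_le] at hm
      rw [Pi.inv_apply, map_inv₀, pow_zero]
      exact inv_le_one_of_one_le₀ hm.le

namespace UltraComplex

open QuasiAbs

variable {d : ℕ} {V : ℕ → QuasiAbs d}

theorem of_mem_boundedSubring {f : ℕ → ℂ} :
    of f ∈ boundedSubring V ↔
      ∃ k : ℕ, ∀ᶠ m in Filter.hyperfilter ℕ, (V m).v (f m) ≤ (V m).Q ^ k := by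
  refine ⟨?_, fun h => ⟨f, rfl, h⟩⟩
  rintro ⟨g, hg, k, hk⟩
  refine ⟨k, ?_⟩
  filter_upwards [hk, Filter.Germ.coe_eq.1 hg] with m h1 h2
  rwa [← h2]

theorem natCast_inv_mem_boundedSubring {n : ℕ} (h1 : 1 ≤ n) (h2 : n ≤ d) :
    (n : UltraComplex) ≠ 0 ∧ (n : UltraComplex)⁻¹ ∈ boundedSubring V := by
  have hn : (n : ℂ) ≠ 0 := Nat.cast_ne_zero.2 (by omega)
  have hu : of (fun _ => (n : ℂ)) = (n : UltraComplex) := map_natCast of n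
  have hinv : of (fun _ => (n : ℂ)⁻¹) * (n : UltraComplex) = 1 := by
    rw [← hu, ← map_mul, ← map_one of]
    congr 1
    ext m
    simp [hn]
  refine ⟨right_ne_zero_of_mul_eq_one hinv, ?_⟩
  rw [← eq_inv_of_mul_eq_one_left hinv, of_mem_boundedSubring]
  refine ⟨1, .of_forall fun m => ?_⟩
  rw [map_inv₀, pow_one]
  have h := (V m).one_le_mul_natCast n h1 h2
  rwa [inv_le_iff_one_le_mul₀ (zero_lt_iff.2 ((_root_.map_ne_zero _).2 hn))]

theorem eval_monicPoly_of {n : ℕ} (c : ℕ → Fin (n - 1) → ℂ) (x : ℕ → ℂ) :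
    (monicPoly n fun i => of fun m => c m i).eval (of x) =
      of fun m => (monicPoly n (c m)).eval (x m) := by
  rw [← map_monicPoly, eval_map_apply]
  congr 1
  ext m
  simp [eval_monicPoly]

theorem derivative_monicPoly_of {n : ℕ} {c s : ℕ → Fin (n - 1) → ℂ}
    (h : ∀ m, derivative (monicPoly n (c m)) = C (n : ℂ) * ∏ i, (X - C (s m i))) :
    derivative (monicPoly n fun i => of fun m => c m i) =
      C (n : UltraComplex) * ∏ i, (X - C (of fun m => s m i)) := by
  have key : derivative (monicPoly n fun i => fun m => c m i) =
      C (n : ℕ → ℂ) * ∏ i, (X - C (fun m => s m i)) := by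
    ext k m
    have hm : (monicPoly n fun i => fun m => c m i).map (Pi.evalRingHom (fun _ => ℂ) m) =
        monicPoly n (c m) := map_monicPoly _ _
    have := congrArg (fun q => q.coeff k) (h m)
    rw [← hm, derivative_map, coeff_map] at this
    have hprod : (C (n : ℕ → ℂ) * ∏ i, (X - C (fun m => s m i))).map
        (Pi.evalRingHom (fun _ => ℂ) m) = C (n : ℂ) * ∏ i, (X - C (s m i)) := by
      rw [Polynomial.map_mul, Polynomial.map_prod, map_C, map_natCast]
      simp only [Polynomial.map_sub, map_X, map_C, Pi.evalRingHom_apply]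
    rw [← hprod, coeff_map] at this
    exact this
  rw [← map_monicPoly, derivative_map, key]
  simp [Polynomial.map_prod]

theorem hasDominatedPath_of {n p : ℕ} {a : ℕ → Fin (n - 1) → ℂ} {b : ℕ → Fin (p - 1) → ℂ}
    {σ : ℕ → ℂ}
    (h : ∀ m, HasDominatedPath {r | (V m).v r ≤ 1} (monicPoly n (a m)) (monicPoly p (b m)) 1
      (σ m)) :
    HasDominatedPath (boundedSubring V : Set UltraComplex) (monicPoly n fun i => of fun m => a m i)
      (monicPoly p fun i => of fun m => b m i) 1 (of σ) := by
  choose x₁ x₂ z w h1 h2 h3 h4 h5 h6 h7 using h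
  have hdom : ∀ x y : ℕ → ℂ, (∀ m, ∃ r ∈ {r | (V m).v r ≤ 1}, x m = r * y m) →
      ∃ r ∈ (boundedSubring V : Set UltraComplex), of x = r * of y := by
    intro x y hxy
    choose r hr hr' using hxy
    refine ⟨of r, of_mem_boundedSubring.2 ⟨0, .of_forall fun m => ?_⟩, ?_⟩
    · rw [pow_zero]
      exact hr m
    · rw [← map_mul]
      exact congrArg of (funext hr')
  refine ⟨of x₁, of x₂, of z, of w, ?_, ?_, ?_, hdom _ _ h4, hdom _ _ h5, hdom _ _ h6,
    hdom _ _ h7⟩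
  all_goals rw [one_mul, eval_monicPoly_of, eval_monicPoly_of]
  · exact congrArg of (funext fun m => by rw [h1, one_mul])
  · exact congrArg of (funext fun m => by rw [h2, one_mul])
  · exact congrArg of (funext fun m => by rw [h3, one_mul])

end UltraComplex

theorem QuasiAbs.exists_bound {d e : ℕ} (he : 1 ≤ e) (hde : e < d) :
    ∃ M : ℕ, ∀ (V : QuasiAbs d) (a : Fin (d - 1) → ℂ) (b : Fin (e - 1) → ℂ), IsPCC d e a b →
      (∀ i, V.v (a i) ≤ V.Q ^ M) ∧ ∀ j, V.v (b j) ≤ V.Q ^ M := by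
  by_contra! hcon
  choose V a b hpcc hbad using hcon
  have hd : 1 ≤ d := by omega
  choose c hc using fun m => exists_derivative_monicPoly hd (a m)
  choose t ht using fun m => exists_derivative_monicPoly he (b m)
  have hzc : ∀ m i, IsCritPt d e (a m) (b m) (c m i) := fun m i => by
    refine .inl ?_
    rw [deriv_fC, hc, eval_mul, eval_prod, Finset.prod_eq_zero (Finset.mem_univ i) (by simp),
      mul_zero]
  have hzt : ∀ m i, ∃ s, fC e (b m) (t m i) = fC d (a m) s := fun m i => by
    obtain ⟨s, hs⟩ := IsAlgClosed.exists_root (monicPoly d (a m) - C (fC e (b m) (t m i))) (by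
      rw [degree_sub_C, degree_eq_natDegree (monic_monicPoly _ hd).ne_zero, natDegree_monicPoly _ hd]
      · exact_mod_cast (by omega : d ≠ 0)
      · rw [degree_eq_natDegree (monic_monicPoly _ hd).ne_zero, natDegree_monicPoly _ hd]
        exact_mod_cast hd)
    refine ⟨s, ?_⟩
    rw [IsRoot, eval_sub, eval_C, sub_eq_zero] at hs
    rw [fC_eq_eval (a m), hs]
  choose s hs using hzt
  have hsc : ∀ m i, IsCritPt d e (a m) (b m) (s m i) := fun m i => by
    refine .inr ⟨t m i, hs m i, ?_⟩
    rw [deriv_fC, ht, eval_mul, eval_prod, Finset.prod_eq_zero (Finset.mem_univ i) (by simp),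
      mul_zero]
  have hn : ∀ i : ℕ, 1 ≤ i → i ≤ d →
      (i : UltraComplex) ≠ 0 ∧ (i : UltraComplex)⁻¹ ∈ boundedSubring V :=
    fun i h1 h2 => UltraComplex.natCast_inv_mem_boundedSubring h1 h2
  have hder := UltraComplex.derivative_monicPoly_of hc
  have hder' := UltraComplex.derivative_monicPoly_of ht
  obtain ⟨hcO, htO⟩ := critical_mem (boundedSubring V) he hde (monic_monicPoly _ hd)
    (monic_monicPoly _ he) (natDegree_monicPoly _ hd) (natDegree_monicPoly _ he)
    (coeff_monicPoly_zero _ hd) (coeff_monicPoly_zero _ he) hn hder hder'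
    (fun i => UltraComplex.hasDominatedPath_of fun m =>
      (V m).hasDominatedPath (hpcc m) (hzc m i))
    (fun i => ⟨UltraComplex.of fun m => s m i, by
      rw [UltraComplex.eval_monicPoly_of, UltraComplex.eval_monicPoly_of]
      exact congrArg UltraComplex.of (funext fun m => by rw [← fC_eq_eval, ← fC_eq_eval, hs]),
      UltraComplex.hasDominatedPath_of fun m => (V m).hasDominatedPath (hpcc m) (hsc m i)⟩)
  have hlim : ∀ k : ℕ, ∀ᶠ m in Filter.hyperfilter ℕ, (V m).Q ^ k ≤ (V m).Q ^ m := fun k => by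
    filter_upwards [Nat.hyperfilter_le_atTop (Filter.eventually_ge_atTop k)] with m hm
    exact pow_le_pow_right₀ (V m).one_le_Q hm
  have hbound : ∀ f : ℕ → ℂ, UltraComplex.of f ∈ boundedSubring V →
      ∀ᶠ m in Filter.hyperfilter ℕ, (V m).v (f m) ≤ (V m).Q ^ m := fun f hf => by
    obtain ⟨k, hk⟩ := UltraComplex.of_mem_boundedSubring.1 hf
    filter_upwards [hk, hlim k] with m h1 h2 using h1.trans h2
  have ha : ∀ᶠ m in Filter.hyperfilter ℕ, ∀ i, (V m).v (a m i) ≤ (V m).Q ^ m :=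
    Filter.eventually_all.2 fun i => hbound (fun m => a m i) <| by
      rw [← coeff_monicPoly_succ (fun i => UltraComplex.of fun m => a m i) i]
      exact coeff_mem_of_derivative_eq_prod _ (natDegree_monicPoly _ hd).le
        (coeff_monicPoly_zero _ hd) hn hder hcO _
  have hb : ∀ᶠ m in Filter.hyperfilter ℕ, ∀ i, (V m).v (b m i) ≤ (V m).Q ^ m :=
    Filter.eventually_all.2 fun i => hbound (fun m => b m i) <| by
      rw [← coeff_monicPoly_succ (fun i => UltraComplex.of fun m => b m i) i]
      exact coeff_mem_of_derivative_eq_prod _ (natDegree_monicPoly _ he).le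
        (coeff_monicPoly_zero _ he) (fun i h1 h2 => hn i h1 (by omega)) hder' htO _
  obtain ⟨m, ham, hbm⟩ := (ha.and hb).exists
  obtain ⟨j, hj⟩ := hbad m ham
  exact hj.not_ge (hbm j)

theorem isIntegral_of_forall_mem_valuationSubring {K : Type*} [Field K] {x : K}
    (h : ∀ A : ValuationSubring K, x ∈ A) : IsIntegral ℤ x := by
  have hx : x ∈ (integralClosure (Subring.closure (∅ : Set K)) K).toSubring := by
    rw [← iInf_valuationSubring_superset, Subring.mem_iInf]
    exact fun V => h V.1
  have hint : IsIntegral (Subring.closure (∅ : Set K)) x := hx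
  rw [Subring.closure_empty] at hint
  obtain ⟨p, hp, hpx⟩ := hint
  obtain ⟨q, hq, -, hqm⟩ := lifts_and_natDegree_eq_and_monic
    (f := (Int.castRingHom K).rangeRestrict) (p := p)
    ((mem_lifts p).2 (map_surjective _ (Int.castRingHom K).rangeRestrict_surjective p)) hp
  refine ⟨q, hqm, ?_⟩
  rw [← hq, eval₂_map] at hpx
  rwa [show algebraMap ℤ K = _ from RingHom.ext_int _ _]

/-- The quasi-absolute value given by a valuation ring. -/
noncomputable def QuasiAbs.ofValuationSubring (d : ℕ) (A : ValuationSubring ℂ) : QuasiAbs d where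
  Γ := A.ValueGroup
  v := A.valuation.toMonoidWithZeroHom
  Q := (A.valuation (d.factorial : ℂ))⁻¹
  one_le_Q := (one_le_inv₀ (zero_lt_iff.2 ((_root_.map_ne_zero _).2
    (Nat.cast_ne_zero.2 d.factorial_ne_zero)))).2 ((A.valuation_le_one_iff _).2 (natCast_mem A _))
  map_add_le x y := (A.valuation.map_add x y).trans <| le_mul_of_one_le_left' <|
    (one_le_inv₀ (zero_lt_iff.2 ((_root_.map_ne_zero _).2
      (Nat.cast_ne_zero.2 d.factorial_ne_zero)))).2
        ((A.valuation_le_one_iff _).2 (natCast_mem A _))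
  v_neg := A.valuation.map_neg
  one_le_mul_natCast n h1 h2 := by
    obtain ⟨m, hm⟩ := Nat.dvd_factorial h1 h2
    have h0 : A.valuation (d.factorial : ℂ) ≠ 0 :=
      (_root_.map_ne_zero _).2 (Nat.cast_ne_zero.2 d.factorial_ne_zero)
    have hle : A.valuation (d.factorial : ℂ) ≤ A.valuation n := by
      rw [hm, Nat.cast_mul, map_mul]
      exact mul_le_of_le_one_right' ((A.valuation_le_one_iff _).2 (natCast_mem A m))
    exact (le_inv_mul_iff₀ (zero_lt_iff.2 h0)).2 ((mul_one _).trans_le hle)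

open NNReal in
/-- The absolute value of the image under an embedding. -/
noncomputable def QuasiAbs.ofEmbedding (d : ℕ) (φ : ℂ →+* ℂ) : QuasiAbs d where
  Γ := ℝ≥0
  v := (nnnormHom : ℂ →*₀ ℝ≥0).comp φ.toMonoidWithZeroHom
  Q := 2
  one_le_Q := one_le_two
  map_add_le x y := by
    change ‖φ (x + y)‖₊ ≤ 2 * max ‖φ x‖₊ ‖φ y‖₊
    rw [map_add, two_mul]
    exact (nnnorm_add_le _ _).trans (add_le_add (le_max_left ..) (le_max_right ..))
  v_neg x := by
    change ‖φ (-x)‖₊ = ‖φ x‖₊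
    rw [map_neg, nnnorm_neg]
  one_le_mul_natCast n h1 _ := by
    change 1 ≤ 2 * ‖φ n‖₊
    rw [map_natCast, RCLike.nnnorm_natCast]
    have : (1 : ℝ≥0) ≤ n := by exact_mod_cast h1
    exact this.trans (le_mul_of_one_le_left' one_le_two)

theorem exists_ringHom_extending {F K : Type*} [Field F] [Field K] [IsAlgClosed K] [Algebra F K]
    (ψ : F ≃+* F) : ∃ φ : K →+* K, ∀ x, φ (algebraMap F K x) = algebraMap F K (ψ x) := by
  obtain ⟨s, hs⟩ := exists_isTranscendenceBasis F K
  let A := Algebra.adjoin F (Set.range ((↑) : s → K))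
  have : IsAlgClosure A K := IsAlgClosed.isAlgClosure_of_transcendence_basis _ hs
  let ε : A ≃+* A := hs.1.aevalEquiv.symm.toRingEquiv.trans
    ((MvPolynomial.mapEquiv s ψ).trans hs.1.aevalEquiv.toRingEquiv)
  refine ⟨IsAlgClosure.equivOfEquiv K K ε, fun x => ?_⟩
  have hε : ε (algebraMap F A x) = algebraMap F A (ψ x) := by
    change hs.1.aevalEquiv (MvPolynomial.map (ψ : F →+* F)
      (hs.1.aevalEquiv.symm (algebraMap F A x))) = _
    rw [AlgEquiv.commutes, MvPolynomial.algebraMap_eq, MvPolynomial.map_C,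
      ← MvPolynomial.algebraMap_eq, AlgEquiv.commutes]
    rfl
  have h := IsAlgClosure.equivOfEquiv_algebraMap K K ε (algebraMap F A x)
  rw [hε] at h
  exact h

theorem exists_ringHom_apply_eq_of_aeval_minpoly {k K : Type*} [Field k] [Field K] [Algebra k K]
    [IsAlgClosed K] {x y : K} (hx : IsAlgebraic k x) (hy : aeval y (minpoly k x) = 0) :
    ∃ φ : K →+* K, φ x = y := by
  have hyalg : IsAlgebraic k y := ⟨_, minpoly.ne_zero hx.isIntegral, hy⟩
  have := algebraicClosure.isAlgClosure k K
  have : Normal k (algebraicClosure k K) := IsAlgClosure.normal k _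
  have hmin := minpoly.algebraMap_eq (A := k) (algebraMap (algebraicClosure k K) K).injective
    ⟨x, mem_algebraicClosure_iff.2 hx⟩
  obtain ⟨ψ, hψ⟩ := minpoly.exists_algEquiv_of_root' (K := k) (L := algebraicClosure k K)
    (x := ⟨y, mem_algebraicClosure_iff.2 hyalg⟩) (y := ⟨x, mem_algebraicClosure_iff.2 hx⟩)
    (Algebra.IsAlgebraic.isAlgebraic _) (by
      refine (algebraMap (algebraicClosure k K) K).injective ?_
      rw [← aeval_algebraMap_apply, map_zero, ← hmin]
      exact hy)
  obtain ⟨φ, hφ⟩ := exists_ringHom_extending (K := K) ψ.toRingEquiv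
  refine ⟨φ, (hφ ⟨x, mem_algebraicClosure_iff.2 hx⟩).trans ?_⟩
  exact congrArg (algebraMap (algebraicClosure k K) K) hψ

theorem finite_of_isIntegral_of_norm_le (D : ℕ) (B : ℝ) :
    {x : ℂ | IsIntegral ℤ x ∧ (minpoly ℚ x).natDegree ≤ D ∧ ∀ φ : ℂ →+* ℂ, ‖φ x‖ ≤ B}.Finite := by
  classical
  let N := Nat.ceil (max B 1 ^ D * D.choose (D / 2))
  have := bUnion_roots_finite (algebraMap ℤ ℂ) D (Set.finite_Icc (-N : ℤ) N)
  refine this.subset fun x hx => ?_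
  obtain ⟨hint, hdeg, hφ⟩ := hx
  simp_rw [Set.mem_iUnion]
  have hmin := minpoly.isIntegrallyClosed_eq_field_fractions' ℚ hint
  have hintQ : IsIntegral ℚ x := hint.tower_top
  refine ⟨_, ⟨?_, fun i => ?_⟩, mem_rootSet.2 ⟨minpoly.ne_zero hint, minpoly.aeval ℤ x⟩⟩
  · rwa [← (minpoly.monic hint).natDegree_map (algebraMap ℤ ℚ), ← hmin]
  have hbdd := coeff_bdd_of_roots_le (algebraMap ℚ ℂ) (B := B) (minpoly.monic hintQ)
    (IsAlgClosed.splits _) hdeg (fun z hz => by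
      obtain ⟨φ, rfl⟩ := exists_ringHom_apply_eq_of_aeval_minpoly hintQ.isAlgebraic
        (mem_aroots.1 hz).2
      exact hφ φ) i
  rw [hmin, coeff_map, coeff_map, eq_intCast, eq_ratCast, Rat.cast_intCast,
    Complex.norm_intCast] at hbdd
  rw [Set.mem_Icc, ← abs_le, ← @Int.cast_le ℝ, Int.cast_abs]
  exact hbdd.trans (by exact_mod_cast Nat.le_ceil _)

theorem finite_of_forall_quasiAbs_le (d D M : ℕ) :
    {x : ℂ | (∃ q : ℚ[X], q ≠ 0 ∧ q.natDegree ≤ D ∧ aeval x q = 0) ∧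
      ∀ V : QuasiAbs d, V.v x ≤ V.Q ^ M}.Finite := by
  have hN : ((d.factorial ^ M : ℕ) : ℂ) ≠ 0 :=
    Nat.cast_ne_zero.2 (pow_ne_zero _ d.factorial_ne_zero)
  refine Set.Finite.of_finite_image (f := fun x => ((d.factorial ^ M : ℕ) : ℂ) * x) ?_
    (mul_right_injective₀ hN).injOn
  refine (finite_of_isIntegral_of_norm_le D (‖((d.factorial ^ M : ℕ) : ℂ)‖ * 2 ^ M)).subset ?_
  rintro _ ⟨x, ⟨⟨q, hq0, hqD, hq⟩, hx⟩, rfl⟩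
  refine ⟨isIntegral_of_forall_mem_valuationSubring fun A => ?_, ?_, fun φ => ?_⟩
  · have h : A.valuation x ≤ (A.valuation (d.factorial : ℂ))⁻¹ ^ M :=
      hx (QuasiAbs.ofValuationSubring d A)
    rw [← A.valuation_le_one_iff, map_mul, Nat.cast_pow, map_pow]
    refine (mul_le_mul_right h _).trans ?_
    rw [← mul_pow, mul_inv_cancel₀ ((_root_.map_ne_zero _).2
      (Nat.cast_ne_zero.2 d.factorial_ne_zero)), one_pow]
  · have hroot : aeval (((d.factorial ^ M : ℕ) : ℂ) * x)
        (q.scaleRoots ((d.factorial ^ M : ℕ) : ℚ)) = 0 := by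
      simpa using scaleRoots_aeval_eq_zero (r := ((d.factorial ^ M : ℕ) : ℚ)) hq
    refine le_trans ?_ hqD
    rw [← natDegree_scaleRoots q ((d.factorial ^ M : ℕ) : ℚ)]
    exact natDegree_le_of_dvd (minpoly.dvd ℚ _ hroot) (scaleRoots_ne_zero hq0 _)
  · have h : ‖φ x‖₊ ≤ 2 ^ M := hx (QuasiAbs.ofEmbedding d φ)
    rw [map_mul, map_natCast, norm_mul]
    refine mul_le_mul_of_nonneg_left ?_ (norm_nonneg _)
    exact_mod_cast h

theorem finitely_many_PCC_of_bounded_algebraic_degree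
    (d e D : ℕ) (he : 1 ≤ e) (hde : e < d) (hD : 1 ≤ D) :
    { p : (Fin (d - 1) → ℂ) × (Fin (e - 1) → ℂ) |
      (∀ i, ∃ q : ℚ[X], q ≠ 0 ∧ q.natDegree ≤ D ∧ aeval (p.1 i) q = 0) ∧
      (∀ j, ∃ q : ℚ[X], q ≠ 0 ∧ q.natDegree ≤ D ∧ aeval (p.2 j) q = 0) ∧
      IsPCC d e p.1 p.2 }.Finite := by
  obtain ⟨M, hM⟩ := QuasiAbs.exists_bound he hde
  have hT := finite_of_forall_quasiAbs_le d D M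
  refine ((Set.Finite.pi' fun _ : Fin (d - 1) => hT).prod
    (Set.Finite.pi' fun _ : Fin (e - 1) => hT)).subset ?_
  rintro ⟨a, b⟩ ⟨ha, hb, hpcc⟩
  exact ⟨fun i => ⟨ha i, fun V => (hM V a b hpcc).1 i⟩,
    fun j => ⟨hb j, fun V => (hM V a b hpcc).2 j⟩⟩
end

section
/- Fix integers d > e ≥ 1, and let a_1, …, a_{d−1}, b_1, …, b_{e−1} ∈ ℂ be such that the correspondence C : y^e + b_{e−1}y^{e−1} + ⋯ + b_1 y = x^d + a_{d−1}x^{d−1} + ⋯ + a_1 x is postcritically constrained. Then every a_i and every b_j is algebraic over ℚ. -/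
open Polynomial

/-- Over a field of characteristic zero, if every critical point of a split monic polynomial is one
of its roots, then the polynomial has at most one root. -/
lemma root_eq_of_forall_derivative_root {k : Type*} [Field k] [CharZero k] {s t : Multiset k}
    (hd : derivative (s.map (X - C ·)).prod = C (Multiset.card s : k) * (t.map (X - C ·)).prod)
    (hroot : ∀ c ∈ t, c ∈ s) {x y : k} (hx : x ∈ s) (hy : y ∈ s) : x = y := by
  classical
  set F : k[X] := (s.map (X - C ·)).prod with hF
  have hFm : F.Monic := monic_multiset_prod_of_monic _ _ fun c _ => monic_X_sub_C c
  have hFr : F.roots = s := roots_multiset_prod_X_sub_C s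
  have hFd : F.natDegree = Multiset.card s := natDegree_multiset_prod_X_sub_C_eq_card s
  have hpos : 0 < Multiset.card s := Multiset.card_pos_iff_exists_mem.2 ⟨x, hx⟩
  have hs0 : (Multiset.card s : k) ≠ 0 := by exact_mod_cast hpos.ne'
  have hdr : (derivative F).roots = t := by
    rw [hd, roots_C_mul _ hs0, roots_multiset_prod_X_sub_C]
  have hcard : Multiset.card t + 1 = Multiset.card s := by
    have h1 := natDegree_derivative F
    rw [hd, natDegree_C_mul hs0, natDegree_multiset_prod_X_sub_C_eq_card, hFd] at h1
    omega
  have hsum : t + s.dedup = s := by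
    ext c
    rw [Multiset.count_add, Multiset.count_dedup]
    by_cases hc : c ∈ s
    · have hcr : F.IsRoot c := by
        rw [← hFr] at hc
        exact isRoot_of_mem_roots hc
      have h1 := derivative_rootMultiplicity_of_root hcr
      rw [← count_roots, ← count_roots, hdr, hFr] at h1
      have h2 := Multiset.count_pos.2 hc
      rw [if_pos hc]
      omega
    · rw [if_neg hc, Multiset.count_eq_zero.2 hc, Multiset.count_eq_zero.2 fun h => hc (hroot c h)]
  have hone : Multiset.card s.dedup = 1 := by
    have := congrArg Multiset.card hsum
    rw [Multiset.card_add] at this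
    omega
  obtain ⟨z, hz⟩ := Multiset.card_eq_one.1 hone
  have hx' := Multiset.mem_dedup.2 hx
  have hy' := Multiset.mem_dedup.2 hy
  rw [hz, Multiset.mem_singleton] at hx' hy'
  rw [hx', hy']

/-- A polynomial over a local ring of residue characteristic zero with roots `0` and `1` has a
critical value which is a unit. -/
lemma exists_isUnit_eval_critical {R : Type*} [CommRing R] [IsLocalRing R]
    [CharZero (IsLocalRing.ResidueField R)] {s t : Multiset R}
    (hd : derivative (s.map (X - C ·)).prod = C (Multiset.card s : R) * (t.map (X - C ·)).prod)
    (h0 : (0 : R) ∈ s) (h1 : (1 : R) ∈ s) :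
    ∃ c ∈ t, IsUnit (eval c (s.map (X - C ·)).prod) := by
  by_contra! hcon
  have hmap : ∀ u : Multiset R, ((u.map (X - C ·)).prod).map (IsLocalRing.residue R) =
      ((u.map (IsLocalRing.residue R)).map (X - C ·)).prod := by
    intro u
    rw [Polynomial.map_multiset_prod, Multiset.map_map, Multiset.map_map]
    simp
  refine zero_ne_one (α := IsLocalRing.ResidueField R)
    (root_eq_of_forall_derivative_root (s := s.map (IsLocalRing.residue R))
      (t := t.map (IsLocalRing.residue R)) ?_ ?_ ?_ ?_)
  · have h := congrArg (Polynomial.map (IsLocalRing.residue R)) hd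
    rw [← derivative_map, Polynomial.map_mul, hmap, hmap, map_C, map_natCast] at h
    rw [h, Multiset.card_map]
  · intro c hc
    obtain ⟨c, hct, rfl⟩ := Multiset.mem_map.1 hc
    have h2 : IsLocalRing.residue R (eval c (s.map (X - C ·)).prod) = 0 :=
      (IsLocalRing.residue_eq_zero_iff _).2 ((IsLocalRing.mem_maximalIdeal _).2 (hcon c hct))
    rw [← eval_map_apply, hmap] at h2
    rw [← roots_multiset_prod_X_sub_C (s.map (IsLocalRing.residue R))]
    exact (mem_roots (monic_multiset_prod_of_monic _ _ fun c _ => monic_X_sub_C c).ne_zero).2 h2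
  · exact Multiset.mem_map.2 ⟨0, h0, map_zero _⟩
  · exact Multiset.mem_map.2 ⟨1, h1, map_one _⟩

lemma exists_root_max {K Γ : Type*} [Field K] [LinearOrderedCommGroupWithZero Γ]
    (v : Valuation K Γ) {p : K[X]} (hp : p.Monic) (h0 : p.eval 0 = 0) :
    ∃ α ∈ p.roots, ∀ r ∈ p.roots, v r ≤ v α := by
  classical
  obtain ⟨α, hα, h⟩ := p.roots.toFinset.exists_max_image v
    ⟨0, Multiset.mem_toFinset.2 ((mem_roots hp.ne_zero).2 h0)⟩
  exact ⟨α, Multiset.mem_toFinset.1 hα, fun r hr => h r (Multiset.mem_toFinset.2 hr)⟩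

section Valuation

variable {K Γ : Type*} [Field K] [IsAlgClosed K] [LinearOrderedCommGroupWithZero Γ]
  (v : Valuation K Γ)

lemma valuation_eval_eq_prod {p : K[X]} (hp : p.Monic) (x : K) :
    v (p.eval x) = (p.roots.map fun r => v (x - r)).prod := by
  rw [(IsAlgClosed.splits p).eval_eq_prod_roots_of_monic hp, map_multiset_prod, Multiset.map_map]
  rfl

lemma valuation_eval_of_lt {p : K[X]} (hp : p.Monic) {x : K}
    (hx : ∀ r ∈ p.roots, v r < v x) : v (p.eval x) = v x ^ p.natDegree := by
  rw [valuation_eval_eq_prod v hp, (IsAlgClosed.splits p).natDegree_eq_card_roots,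
    Multiset.map_congr rfl fun r hr => v.map_sub_eq_of_lt_left (hx r hr), Multiset.map_const',
    Multiset.prod_replicate]

lemma valuation_eval_le {p : K[X]} (hp : p.Monic) (h0 : p.eval 0 = 0) {x : K} {M : Γ}
    (hx : v x ≤ M) (hM : ∀ r ∈ p.roots, v r ≤ M) :
    v (p.eval x) ≤ v x * M ^ (p.natDegree - 1) := by
  obtain ⟨u, hu⟩ := Multiset.exists_cons_of_mem ((mem_roots hp.ne_zero).2 h0)
  rw [valuation_eval_eq_prod v hp, (IsAlgClosed.splits p).natDegree_eq_card_roots, hu,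
    Multiset.map_cons, Multiset.prod_cons, sub_zero, Multiset.card_cons, Nat.add_sub_cancel]
  refine mul_le_mul_right ?_ _
  refine (Multiset.prod_le_pow_card _ M ?_).trans_eq (by rw [Multiset.card_map])
  intro y hy
  obtain ⟨r, hr, rfl⟩ := Multiset.mem_map.1 hy
  exact v.map_sub_le hx (hM r (hu ▸ Multiset.mem_cons_of_mem hr))

lemma exists_critical_of_roots_le_one [CharZero K] (O : ValuationSubring K)
    [CharZero (IsLocalRing.ResidueField O)] {p : K[X]} (hp : p.Monic) (h0 : p.eval 0 = 0)
    (h1 : p.eval 1 = 0) (hr : ∀ r ∈ p.roots, O.valuation r ≤ 1) :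
    ∃ c, p.derivative.eval c = 0 ∧ 1 ≤ O.valuation (p.eval c) := by
  by_contra! hcon
  have hps := (IsAlgClosed.splits p).eq_prod_roots_of_monic hp
  have hcard := (IsAlgClosed.splits p).natDegree_eq_card_roots
  have hpos : 0 < Multiset.card p.roots :=
    Multiset.card_pos_iff_exists_mem.2 ⟨0, (mem_roots hp.ne_zero).2 h0⟩
  have hlead : p.derivative.leadingCoeff = (Multiset.card p.roots : K) := by
    rw [leadingCoeff, natDegree_derivative, coeff_derivative, hcard, Nat.sub_add_cancel hpos,
      ← hcard, hp.coeff_natDegree, one_mul]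
    rw [hcard]
    norm_cast
    exact Nat.sub_add_cancel hpos
  have hds := (IsAlgClosed.splits p.derivative).eq_prod_roots
  rw [hlead] at hds
  have hcr : ∀ c ∈ p.derivative.roots, O.valuation c ≤ 1 := by
    intro c hc
    by_contra! hlt
    have h2 := hcon c (isRoot_of_mem_roots hc)
    rw [valuation_eval_of_lt _ hp fun r hr' => (hr r hr').trans_lt hlt] at h2
    exact absurd (one_le_pow_of_one_le' hlt.le _) h2.not_ge
  obtain ⟨s, hs⟩ : ∃ s : Multiset O, s.map O.subtype = p.roots := by
    have := Multiset.canLift (fun a : O => (a : K)) (fun x => x ∈ O) |>.prf p.roots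
      fun r hr' => (O.valuation_le_one_iff r).1 (hr r hr')
    exact this
  obtain ⟨t, ht⟩ : ∃ s : Multiset O, s.map O.subtype = p.derivative.roots := by
    have := Multiset.canLift (fun a : O => (a : K)) (fun x => x ∈ O) |>.prf p.derivative.roots
      fun r hr' => (O.valuation_le_one_iff r).1 (hcr r hr')
    exact this
  have hmap : ∀ u : Multiset O, ((u.map (X - C ·)).prod).map O.subtype =
      ((u.map O.subtype).map (X - C ·)).prod := by
    intro u
    rw [Polynomial.map_multiset_prod, Multiset.map_map, Multiset.map_map]
    simp
  have hinj : Function.Injective O.subtype := Subtype.val_injective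
  have hsp : ((s.map (X - C ·)).prod).map O.subtype = p := by rw [hmap, hs, ← hps]
  obtain ⟨c, hc, hu⟩ := exists_isUnit_eval_critical (R := O) (s := s) (t := t) (by
      apply Polynomial.map_injective _ hinj
      rw [← derivative_map, hsp, Polynomial.map_mul, hmap, ht, map_C, map_natCast,
        ← Multiset.card_map O.subtype, hs]
      exact hds)
    (by
      have : O.subtype 0 ∈ s.map O.subtype := by
        rw [hs, map_zero]; exact (mem_roots hp.ne_zero).2 h0
      exact (Multiset.mem_map_of_injective hinj).1 this)
    (by
      have : O.subtype 1 ∈ s.map O.subtype := by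
        rw [hs, map_one]; exact (mem_roots hp.ne_zero).2 h1
      exact (Multiset.mem_map_of_injective hinj).1 this)
  have hlt := hcon (O.subtype c) (isRoot_of_mem_roots (ht ▸ Multiset.mem_map_of_mem _ hc))
  rw [← hsp, eval_map_apply] at hlt
  exact hlt.ne ((O.valuation_eq_one_iff _).1 hu)

/-- A monic polynomial vanishing at `0` has a critical value at least as large as the largest root
raised to the degree, in residue characteristic zero. -/
lemma exists_critical_value_ge [CharZero K] (O : ValuationSubring K)
    [CharZero (IsLocalRing.ResidueField O)] {p : K[X]} (hp : p.Monic) (h0 : p.eval 0 = 0)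
    {α : K} (hα : α ≠ 0) (hroot : α ∈ p.roots)
    (hr : ∀ r ∈ p.roots, O.valuation r ≤ O.valuation α) :
    ∃ c, p.derivative.eval c = 0 ∧ O.valuation α ^ p.natDegree ≤ O.valuation (p.eval c) := by
  set q : K[X] := C (α ^ p.natDegree)⁻¹ * p.comp (C α * X) with hq
  have hαn : α ^ p.natDegree ≠ 0 := pow_ne_zero _ hα
  have hqe : ∀ x, q.eval x = (α ^ p.natDegree)⁻¹ * p.eval (α * x) := by
    intro x; simp [hq]
  have hqd : ∀ x, q.derivative.eval x = (α ^ p.natDegree)⁻¹ * (α * p.derivative.eval (α * x)) := by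
    intro x; simp [hq, derivative_comp]
  have hqm : q.Monic := by
    rw [Monic, hq, leadingCoeff_mul, leadingCoeff_C, leadingCoeff_comp, hp.leadingCoeff,
      leadingCoeff_C_mul_X, one_mul, inv_mul_cancel₀ hαn]
    rw [natDegree_C_mul_X _ hα]
    exact one_ne_zero
  obtain ⟨c, hc, hv⟩ := exists_critical_of_roots_le_one O hqm (by simp [hqe, h0])
    (by rw [hqe, mul_one, isRoot_of_mem_roots hroot, mul_zero]) (by
      intro r hr'
      have h1 : q.eval r = 0 := isRoot_of_mem_roots hr'
      rw [hqe, mul_eq_zero_iff_left (inv_ne_zero hαn)] at h1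
      have h2 := hr _ ((mem_roots hp.ne_zero).2 h1)
      rw [map_mul] at h2
      exact (mul_le_iff_le_one_right (zero_lt_iff.2 ((_root_.map_ne_zero _).2 hα))).1 h2)
  refine ⟨α * c, ?_, ?_⟩
  · rw [hqd] at hc
    simpa [hα] using hc
  · rw [hqe, map_mul, map_inv₀, map_pow] at hv
    have hpos : 0 < O.valuation α ^ p.natDegree :=
      zero_lt_iff.2 (pow_ne_zero _ ((_root_.map_ne_zero _).2 hα))
    rwa [le_inv_mul_iff₀ hpos, mul_one] at hv

/-- A preperiodic path of `g(y) = f(x)` with `deg g < deg f` never enters the basin of infinity. -/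
lemma preperiodic_path_bounded {f g : K[X]} (hf : f.Monic) (hg : g.Monic)
    (hg0 : g.eval 0 = 0) (hd : g.natDegree < f.natDegree) {A B : Γ}
    (hA : ∀ r ∈ f.roots, v r ≤ A) (hB : ∀ r ∈ g.roots, v r ≤ B)
    {x : ℕ → K} (hx : ∀ n, g.eval (x (n + 1)) = f.eval (x n))
    {m n : ℕ} (hmn : m < n) (hper : ∀ k, x (m + k) = x (n + k)) (i : ℕ) :
    v (x i) ≤ A ∨ v (x i) ^ f.natDegree ≤ B ^ g.natDegree ∨ v (x i) ≤ 1 := by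
  by_contra! hi
  have hgpos : 1 ≤ g.natDegree := by
    by_contra! h
    rw [hg.natDegree_eq_zero.1 (by omega)] at hg0
    simp at hg0
  have step : ∀ a b : K, g.eval b = f.eval a →
      (A < v a ∧ B ^ g.natDegree < v a ^ f.natDegree ∧ 1 < v a) → v a < v b := by
    rintro a b hab ⟨h1, h2, h3⟩
    have h4 : v (g.eval b) = v a ^ f.natDegree := by
      rw [hab, valuation_eval_of_lt v hf fun r hr => (hA r hr).trans_lt h1]
    have h5 : B < v b := by
      by_contra! h
      have h6 := valuation_eval_le v hg hg0 h hB
      refine h2.not_ge (h4 ▸ h6.trans ?_)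
      calc v b * B ^ (g.natDegree - 1) ≤ B * B ^ (g.natDegree - 1) := mul_le_mul_left h _
        _ = B ^ g.natDegree := by rw [← pow_succ', Nat.sub_add_cancel hgpos]
    rw [valuation_eval_of_lt v hg fun r hr => (hB r hr).trans_lt h5] at h4
    refine lt_of_pow_lt_pow_left' g.natDegree ?_
    rw [h4]
    exact pow_lt_pow_right₀ h3 hd
  have key : ∀ k, (A < v (x (i + k)) ∧ B ^ g.natDegree < v (x (i + k)) ^ f.natDegree ∧
      1 < v (x (i + k))) := by
    intro k
    induction k with
    | zero => exact hi
    | succ k ih =>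
      have h := step _ _ (hx _) ih
      exact ⟨ih.1.trans h, ih.2.1.trans_le (pow_le_pow_left' h.le _), ih.2.2.trans h⟩
  have hmono : StrictMono fun k => v (x (i + k)) :=
    strictMono_nat_of_lt_succ fun k => step _ _ (hx _) (key k)
  have h1 : v (x (i + m)) < v (x (i + n)) := hmono hmn
  rw [add_comm i m, add_comm i n, hper i] at h1
  exact h1.false

/-- For a postcritically constrained correspondence `g(y) = f(x)` with `deg g < deg f`, the roots of
`f` and `g` lie in every valuation ring of residue characteristic zero. -/
lemma valuation_roots_le_one [CharZero K] (O : ValuationSubring K)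
    [CharZero (IsLocalRing.ResidueField O)] {f g : K[X]} (hf : f.Monic) (hg : g.Monic)
    (hf0 : f.eval 0 = 0) (hg0 : g.eval 0 = 0) (hd : g.natDegree < f.natDegree)
    (hpcc : ∀ σ : K, (f.derivative.eval σ = 0 ∨
        ∃ τ, g.eval τ = f.eval σ ∧ g.derivative.eval τ = 0) →
      ∃ x : ℕ → K, x 0 = σ ∧ (∀ n, g.eval (x (n + 1)) = f.eval (x n)) ∧
        ∃ m n : ℕ, m < n ∧ ∀ k : ℕ, x (m + k) = x (n + k)) :
    (∀ r ∈ f.roots, O.valuation r ≤ 1) ∧ (∀ r ∈ g.roots, O.valuation r ≤ 1) := by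
  obtain ⟨α, hα, hαm⟩ := exists_root_max O.valuation hf hf0
  obtain ⟨β, hβ, hβm⟩ := exists_root_max O.valuation hg hg0
  have hgpos : 1 ≤ g.natDegree := by
    by_contra! h
    rw [hg.natDegree_eq_zero.1 (by omega)] at hg0
    simp at hg0
  have hne : ∀ z : K, 1 < O.valuation z → z ≠ 0 := by
    rintro z hz rfl
    rw [map_zero] at hz
    exact absurd hz zero_le_one.not_gt
  by_cases hcase : O.valuation β ^ g.natDegree ≤ O.valuation α ^ f.natDegree
  · have hA : O.valuation α ≤ 1 := by
      by_contra! hA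
      obtain ⟨c, hc, hcv⟩ := exists_critical_value_ge O hf hf0 (hne α hA) hα hαm
      obtain ⟨x, hx0, hx, m, n, hmn, hper⟩ := hpcc c (Or.inl hc)
      have hy : O.valuation (x 1) ≤ O.valuation α := by
        rcases preperiodic_path_bounded O.valuation hf hg hg0 hd hαm hβm hx hmn hper 1 with
          h | h | h
        · exact h
        · exact le_of_pow_le_pow_left₀ (by omega) zero_le (h.trans hcase)
        · exact h.trans hA.le
      set M := max (O.valuation α) (O.valuation β) with hM
      have h1 := valuation_eval_le O.valuation hg hg0 (hy.trans (le_max_left _ _))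
        fun r hr => (hβm r hr).trans (le_max_right _ _)
      rw [← zero_add 1, hx 0, hx0, zero_add] at h1
      have h2 : O.valuation α ^ f.natDegree ≤ O.valuation α * M ^ (g.natDegree - 1) :=
        hcv.trans (h1.trans (mul_le_mul_left hy _))
      have hMe : M ^ g.natDegree ≤ O.valuation α ^ f.natDegree := by
        rcases max_choice (O.valuation α) (O.valuation β) with h | h
        · rw [hM, h]
          exact pow_le_pow_right' hA.le hd.le
        · rw [hM, h]
          exact hcase
      have h3 : O.valuation α ^ (f.natDegree * g.natDegree) ≤
          O.valuation α ^ (g.natDegree + f.natDegree * (g.natDegree - 1)) := by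
        calc O.valuation α ^ (f.natDegree * g.natDegree)
            = (O.valuation α ^ f.natDegree) ^ g.natDegree := pow_mul _ _ _
          _ ≤ (O.valuation α * M ^ (g.natDegree - 1)) ^ g.natDegree := pow_le_pow_left' h2 _
          _ = O.valuation α ^ g.natDegree * (M ^ g.natDegree) ^ (g.natDegree - 1) := by
            rw [mul_pow, ← pow_mul, ← pow_mul, mul_comm g.natDegree]
          _ ≤ O.valuation α ^ g.natDegree * (O.valuation α ^ f.natDegree) ^ (g.natDegree - 1) :=
            mul_le_mul_right (pow_le_pow_left' hMe _) _
          _ = _ := by rw [← pow_mul, ← pow_add]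
      refine h3.not_gt (pow_lt_pow_right₀ hA ?_)
      obtain ⟨e, he⟩ := Nat.exists_eq_add_of_le' hgpos
      rw [he] at hd ⊢
      rw [Nat.add_sub_cancel, mul_add, mul_one]
      omega
    refine ⟨fun r hr => (hαm r hr).trans hA, fun r hr => (hβm r hr).trans ?_⟩
    by_contra! hB
    exact (hcase.trans (pow_le_one' hA _)).not_gt (one_lt_pow' hB (by omega))
  · push Not at hcase
    have hB : O.valuation β ≤ 1 := by
      by_contra! hB
      obtain ⟨τ, hτ, hτv⟩ := exists_critical_value_ge O hg hg0 (hne β hB) hβ hβm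
      obtain ⟨σ, hσ⟩ : ∃ σ, f.eval σ = g.eval τ := by
        obtain ⟨σ, hσ⟩ := IsAlgClosed.exists_root (f - C (g.eval τ))
          (degree_ne_of_natDegree_ne (n := 0) (by rw [natDegree_sub_C]; omega))
        exact ⟨σ, by simpa [sub_eq_zero] using hσ⟩
      obtain ⟨x, hx0, hx, m, n, hmn, hper⟩ := hpcc σ (Or.inr ⟨τ, hσ.symm, hτ⟩)
      have hy : O.valuation (x 1) ^ f.natDegree ≤ O.valuation β ^ g.natDegree := by
        rcases preperiodic_path_bounded O.valuation hf hg hg0 hd hαm hβm hx hmn hper 1 with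
          h | h | h
        · exact (pow_le_pow_left' h _).trans hcase.le
        · exact h
        · exact (pow_le_one' h _).trans (one_le_pow_of_one_le' hB.le _)
      have hlt : O.valuation β ^ g.natDegree < O.valuation β ^ f.natDegree :=
        pow_lt_pow_right₀ hB hd
      have hyB : O.valuation (x 1) < O.valuation β :=
        lt_of_pow_lt_pow_left' _ (hy.trans_lt hlt)
      have h1 := valuation_eval_le O.valuation hg hg0 hyB.le hβm
      rw [← zero_add 1, hx 0, hx0, zero_add, hσ] at h1
      have h2 := hτv.trans h1
      rw [← Nat.sub_add_cancel hgpos, pow_succ', Nat.add_sub_cancel] at h2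
      have hpos : 0 < O.valuation β ^ (g.natDegree - 1) :=
        zero_lt_iff.2 (pow_ne_zero _ ((_root_.map_ne_zero _).2 (hne β hB)))
      exact hyB.not_ge (le_of_mul_le_mul_right h2 hpos)
    refine ⟨fun r hr => (hαm r hr).trans ?_, fun r hr => (hβm r hr).trans hB⟩
    by_contra! hA
    exact (hcase.trans_le (pow_le_one' hB _)).not_ge (one_le_pow_of_one_le' hA.le _)

lemma coeff_mem_of_valuation_roots_le_one (O : ValuationSubring K) {p : K[X]} (hp : p.Monic)
    (hr : ∀ r ∈ p.roots, O.valuation r ≤ 1) (i : ℕ) : p.coeff i ∈ O := by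
  have h := (IsAlgClosed.splits p).mem_lift_of_roots_mem_range hp O.subtype fun r hr' =>
    ⟨⟨r, (O.valuation_le_one_iff r).1 (hr r hr')⟩, rfl⟩
  obtain ⟨a, ha⟩ := (lifts_iff_coeff_lifts p).1 h i
  exact ha ▸ a.2

end Valuation

lemma charZero_residueField {K : Type*} [Field K] [CharZero K] (O : ValuationSubring K)
    (hO : ∀ q : ℚ, (q : K) ∈ O) : CharZero (IsLocalRing.ResidueField O) := by
  refine charZero_of_inj_zero fun n hn => ?_
  by_contra hn0
  rw [← map_natCast (IsLocalRing.residue O), IsLocalRing.residue_eq_zero_iff,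
    IsLocalRing.mem_maximalIdeal] at hn
  refine hn (IsUnit.of_mul_eq_one ⟨((n : ℚ)⁻¹ : ℚ), hO _⟩ (Subtype.ext ?_))
  have : (n : K) ≠ 0 := Nat.cast_ne_zero.2 hn0
  simp [this]

/-- An element lying in every valuation ring containing `ℚ` is algebraic over `ℚ`. -/
lemma isAlgebraic_of_forall_mem_valuationSubring {K : Type*} [Field K] [CharZero K] {z : K}
    (h : ∀ O : ValuationSubring K, (∀ q : ℚ, (q : K) ∈ O) → z ∈ O) : IsAlgebraic ℚ z := by
  by_contra hz
  have hz' : z ∉ (integralClosure ℚ K).toSubring := fun hmem => hz (IsIntegral.isAlgebraic hmem)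
  have : IsIntegrallyClosedIn (integralClosure ℚ K).toSubring K :=
    inferInstanceAs (IsIntegrallyClosedIn (integralClosure ℚ K) K)
  obtain ⟨O, hle, hO⟩ := Subring.exists_le_valuationSubring_of_isIntegrallyClosedIn hz'
  exact hO (h O fun q => hle (isIntegral_algebraMap (x := q)))

/-- The polynomial whose associated function is `fC dd c`. -/
noncomputable def fCPoly {m : ℕ} (dd : ℕ) (c : Fin m → ℂ) : ℂ[X] :=
  X ^ dd + ∑ i : Fin m, C (c i) * X ^ ((i : ℕ) + 1)

lemma eval_fCPoly {m : ℕ} (dd : ℕ) (c : Fin m → ℂ) (x : ℂ) : (fCPoly dd c).eval x = fC dd c x := by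
  simp [fCPoly, fC, eval_finsetSum]

lemma deriv_fC_s1 {m : ℕ} (dd : ℕ) (c : Fin m → ℂ) (x : ℂ) :
    deriv (fC dd c) x = (fCPoly dd c).derivative.eval x := by
  rw [← Polynomial.deriv]
  simp only [eval_fCPoly]

lemma degree_fCPoly_tail_lt {dd : ℕ} (hdd : 1 ≤ dd) (c : Fin (dd - 1) → ℂ) :
    (∑ i : Fin (dd - 1), C (c i) * X ^ ((i : ℕ) + 1)).degree < (dd : WithBot ℕ) := by
  refine (degree_sum_le _ _).trans_lt ((Finset.sup_lt_iff (WithBot.bot_lt_coe dd)).2 fun i _ => ?_)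
  refine (degree_C_mul_X_pow_le _ _).trans_lt ?_
  have := i.2
  exact Nat.cast_lt.2 (by omega)

lemma monic_fCPoly {dd : ℕ} (hdd : 1 ≤ dd) (c : Fin (dd - 1) → ℂ) : (fCPoly dd c).Monic :=
  monic_X_pow_add (degree_fCPoly_tail_lt hdd c)

lemma natDegree_fCPoly {dd : ℕ} (hdd : 1 ≤ dd) (c : Fin (dd - 1) → ℂ) :
    (fCPoly dd c).natDegree = dd :=
  natDegree_eq_of_degree_eq_some
    (by rw [fCPoly, degree_add_eq_left_of_degree_lt] <;> rw [degree_X_pow]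
        exact degree_fCPoly_tail_lt hdd c)

lemma coeff_fCPoly {dd : ℕ} (c : Fin (dd - 1) → ℂ) (i : Fin (dd - 1)) :
    (fCPoly dd c).coeff ((i : ℕ) + 1) = c i := by
  have hi := i.2
  rw [fCPoly, coeff_add, coeff_X_pow, if_neg (by omega), zero_add, finsetSum_coeff,
    Finset.sum_eq_single i]
  · simp
  · intro j _ hj
    rw [coeff_C_mul_X_pow, if_neg]
    intro h
    exact hj (Fin.ext (by omega))
  · simp

lemma eval_zero_fCPoly {m dd : ℕ} (hdd : 1 ≤ dd) (c : Fin m → ℂ) : (fCPoly dd c).eval 0 = 0 := by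
  simp [eval_fCPoly, fC, Nat.one_le_iff_ne_zero.1 hdd]

theorem PCC_coefficients_algebraic (d e : ℕ) (he : 1 ≤ e) (hde : e < d)
    (a : Fin (d - 1) → ℂ) (b : Fin (e - 1) → ℂ) (hPCC : IsPCC d e a b) :
    (∀ i, IsAlgebraic ℚ (a i)) ∧ (∀ j, IsAlgebraic ℚ (b j)) := by
  have hd : 1 ≤ d := he.trans hde.le
  have key : ∀ O : ValuationSubring ℂ, (∀ q : ℚ, (q : ℂ) ∈ O) →
      (∀ r ∈ (fCPoly d a).roots, O.valuation r ≤ 1) ∧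
        ∀ r ∈ (fCPoly e b).roots, O.valuation r ≤ 1 := by
    intro O hO
    have := charZero_residueField O hO
    refine valuation_roots_le_one O (monic_fCPoly hd a) (monic_fCPoly he b)
      (eval_zero_fCPoly hd a) (eval_zero_fCPoly he b)
      (by rwa [natDegree_fCPoly hd, natDegree_fCPoly he]) ?_
    simpa only [IsPCC, IsCritPt, eval_fCPoly, deriv_fC_s1] using hPCC
  refine ⟨fun i => isAlgebraic_of_forall_mem_valuationSubring fun O hO => ?_,
    fun j => isAlgebraic_of_forall_mem_valuationSubring fun O hO => ?_⟩
  · rw [← coeff_fCPoly a i]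
    exact coeff_mem_of_valuation_roots_le_one O (monic_fCPoly hd a) (key O hO).1 _
  · rw [← coeff_fCPoly b j]
    exact coeff_mem_of_valuation_roots_le_one O (monic_fCPoly he b) (key O hO).2 _
end

section
/- Let p be a prime and let e be an integer with 1 ≤ e < p. Then the set of c ∈ ℂ for which the correspondence C : y^e = x^p + c is postcritically constrained is infinite. -/
open Polynomial

/-- Over a residue ring of characteristic `p`, the backward orbit of `0` under `y ^ e = x ^ p + c`,
with its `j`-th term raised to the power `p ^ j`. -/
def backwardOrbit {S : Type*} [CommRing S] (p e : ℕ) (c : S) : ℕ → S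
  | 0 => 0
  | j + 1 => backwardOrbit p e c j ^ e - c ^ p ^ j

/-- The generic backward path of length `n` from `0` lives in a finite free algebra. -/
theorem exists_free_backwardOrbit {R : Type} [CommRing R] [Nontrivial R] {p : ℕ} (hp : p ≠ 0)
    (e : ℕ) (c : R) (n : ℕ) :
    ∃ (B : Type) (_ : CommRing B) (_ : Algebra R B) (_ : Nontrivial B) (_ : Module.Free R B)
      (_ : Module.Finite R B) (y : ℕ → B),
      y 0 = 0 ∧ ∀ i < n, y (i + 1) ^ p = y i ^ e - algebraMap R B c := by
  induction n with
  | zero => exact ⟨R, _, Algebra.id R, ‹_›, inferInstance, inferInstance, 0, rfl, by simp⟩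
  | succ n ih =>
    obtain ⟨B, _, _, _, _, _, y, hy0, hy⟩ := ih
    let f : B[X] := X ^ p - C (y n ^ e - algebraMap R B c)
    have hf : f.Monic := monic_X_pow_sub_C _ hp
    have hdeg : f.natDegree = p := natDegree_X_pow_sub_C
    have := hf.free_adjoinRoot
    have := hf.finite_adjoinRoot
    have hnt : Nontrivial (AdjoinRoot f) := by
      refine Ideal.Quotient.nontrivial_iff.mpr fun h ↦ hp ?_
      rw [Ideal.span_singleton_eq_top, hf.isUnit_iff] at h
      rw [← hdeg, h, natDegree_one]
    refine ⟨AdjoinRoot f, inferInstance, inferInstance, hnt, Module.Free.trans (S := B),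
      Module.Finite.trans B _, fun i ↦ if i ≤ n then AdjoinRoot.of f (y i) else AdjoinRoot.root f,
      by simp [hy0], fun i hi ↦ ?_⟩
    rw [IsScalarTower.algebraMap_apply R B (AdjoinRoot f), AdjoinRoot.algebraMap_eq]
    rcases (Nat.lt_succ_iff.mp hi).lt_or_eq with h | rfl
    · simp [h.le, Nat.succ_le_of_lt h, ← map_pow, hy i h]
    · have h := AdjoinRoot.eval₂_root f
      simp only [f, eval₂_sub, eval₂_pow, eval₂_X, eval₂_C, sub_eq_zero] at h
      simpa [f] using h

/-- If the norm of `b` vanishes at a geometric point of the base, then `b` vanishes at some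
geometric point above it. -/
theorem exists_algHom_apply_eq_zero_of_norm {R B K : Type*} [CommRing R] [CommRing B] [Algebra R B]
    [Module.Free R B] [Module.Finite R B] [Field K] [IsAlgClosed K] [Algebra R K] {b : B}
    (hb : algebraMap R K (Algebra.norm R b) = 0) : ∃ φ : B →ₐ[R] K, φ b = 0 := by
  classical
  let bs := Module.Free.chooseBasis R B
  let Φ : B →ₐ[R] Matrix _ _ K := ((Algebra.ofId R K).mapMatrix).comp (Algebra.leftMulMatrix bs)
  let Ψ : TensorProduct R K B →ₐ[K] Matrix _ _ K :=
    Algebra.TensorProduct.lift (Algebra.ofId K _) Φ fun x y ↦ Algebra.commutes x (Φ y)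
  have hΨ : Ψ (1 ⊗ₜ b) = Φ b :=
    (Algebra.TensorProduct.lift_tmul _ _ _ _ _).trans (by rw [map_one, one_mul])
  have hnu : ¬ IsUnit (1 ⊗ₜ[R] b : TensorProduct R K B) := fun h ↦ by
    have h := (Matrix.isUnit_iff_isUnit_det _).mp (h.map Ψ)
    rw [hΨ] at h
    refine h.ne_zero ?_
    rw [Algebra.norm_eq_matrix_det bs, RingHom.map_det] at hb
    exact hb
  obtain ⟨M, hM, hbM⟩ := exists_max_ideal_of_mem_nonunits hnu
  let := Ideal.Quotient.field M
  have : Algebra.IsAlgebraic K (TensorProduct R K B ⧸ M) := inferInstance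
  let χ : (TensorProduct R K B ⧸ M) →ₐ[K] K := IsAlgClosed.lift
  refine ⟨((χ.comp (Ideal.Quotient.mkₐ K M)).restrictScalars R).comp
    Algebra.TensorProduct.includeRight, ?_⟩
  simp [Ideal.Quotient.eq_zero_iff_mem.mpr hbM]

theorem map_norm_pow_eq_backwardOrbit_pow {R B S : Type*} [CommRing R] [CommRing B] [Algebra R B]
    [Nontrivial B] [Module.Free R B] [Module.Finite R B] [CommRing S] [IsDomain S] {p : ℕ}
    [Fact p.Prime] [CharP S p] (ψ : R →+* S) {e n : ℕ} {c : R} {y : ℕ → B} (hy0 : y 0 = 0)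
    (hy : ∀ i < n, y (i + 1) ^ p = y i ^ e - algebraMap R B c) :
    ∃ d ≠ 0, ψ (Algebra.norm R (y n)) ^ p ^ n = backwardOrbit p e (ψ c) n ^ d := by
  classical
  let bs := Module.Free.chooseBasis R B
  have : Nonempty (Module.Free.ChooseBasisIndex R B) := bs.index_nonempty
  let Φ : B →+* Matrix _ _ S := ψ.mapMatrix.comp (Algebra.leftMulMatrix bs).toRingHom
  have hc : Φ (algebraMap R B c) = Matrix.scalar _ (ψ c) := by
    ext i j
    simp [Φ, Matrix.algebraMap_matrix_apply, Matrix.scalar, Matrix.diagonal_apply, apply_ite ψ]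
  have key : ∀ i ≤ n, Φ (y i) ^ p ^ i = Matrix.scalar _ (backwardOrbit p e (ψ c) i) := by
    intro i
    induction i with
    | zero => simp [hy0, backwardOrbit]
    | succ i ih =>
      intro hi
      rw [pow_succ', pow_mul, ← map_pow Φ, hy i hi, map_sub, map_pow, hc,
        sub_pow_char_pow_of_commute _ _ (Matrix.scalar_commute _ (Commute.all _) _).symm,
        pow_right_comm, ih (by omega), ← map_pow, ← map_pow, ← map_sub, backwardOrbit]
  refine ⟨Fintype.card (Module.Free.ChooseBasisIndex R B), Fintype.card_ne_zero, ?_⟩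
  have := congrArg Matrix.det (key n le_rfl)
  rw [Matrix.det_pow] at this
  rw [Algebra.norm_eq_matrix_det bs, RingHom.map_det]
  simpa using! this

theorem degree_backwardOrbit_succ {k : Type*} [Field k] {p e : ℕ} (he : 1 ≤ e) (hep : e < p)
    (j : ℕ) : (backwardOrbit p e (X : k[X]) (j + 1)).degree = (p ^ j : ℕ) := by
  have hlt : (backwardOrbit p e (X : k[X]) j ^ e).degree < (X ^ p ^ j : k[X]).degree := by
    rw [degree_X_pow]
    induction j with
    | zero => simp [backwardOrbit, zero_pow (by omega : e ≠ 0)]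
    | succ j ih =>
      rw [degree_pow, backwardOrbit, degree_sub_eq_right_of_degree_lt (by rwa [degree_X_pow]),
        degree_X_pow, nsmul_eq_mul, pow_succ']
      have : 0 < p ^ j := Nat.pow_pos (by omega)
      exact_mod_cast Nat.mul_lt_mul_of_pos_right hep this
  rw [backwardOrbit, degree_sub_eq_right_of_degree_lt hlt, degree_X_pow]

theorem backwardOrbit_succ_ne_zero {k : Type*} [Field k] {p e : ℕ} (he : 1 ≤ e) (hep : e < p)
    (j : ℕ) : backwardOrbit p e (X : k[X]) (j + 1) ≠ 0 := fun h0 ↦ by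
  simpa only [h0, degree_zero, WithBot.bot_ne_natCast] using
    degree_backwardOrbit_succ (k := k) he hep j

/-- From the second step on, the backward orbit of `0` is not a monomial in the parameter. -/
theorem not_associated_backwardOrbit {k : Type*} [Field k] {p e : ℕ} (he : 1 ≤ e) (hep : e < p)
    (j i : ℕ) : ¬ Associated (backwardOrbit p e (X : k[X]) (j + 2)) (X ^ i) := by
  intro h
  have hi := degree_eq_degree_of_associated h
  rw [degree_backwardOrbit_succ he hep, degree_X_pow, Nat.cast_inj] at hi
  have hd : X ^ p ^ (j + 1) ∣ backwardOrbit p e (X : k[X]) (j + 2) := hi ▸ h.symm.dvd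
  rw [backwardOrbit, dvd_sub_self_right] at hd
  have := degree_le_of_dvd hd (pow_ne_zero _ (backwardOrbit_succ_ne_zero he hep j))
  rw [degree_pow _ e, degree_backwardOrbit_succ he hep, degree_X_pow, nsmul_eq_mul,
    pow_succ'] at this
  have h1 : p * p ^ j ≤ e * p ^ j := by exact_mod_cast this
  have h2 : 0 < p ^ j := Nat.pow_pos (by omega)
  exact absurd (Nat.le_of_mul_le_mul_right h1 h2) (by omega)

theorem Nat.apply_add_one_mod {α : Type*} {x : ℕ → α} {l : ℕ} (hl : l ≠ 0) (h : x 0 = x l)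
    (i : ℕ) : x ((i + 1) % l) = x (i % l + 1) := by
  rw [← Nat.mod_add_mod]
  rcases (Nat.succ_le_of_lt (Nat.mod_lt i (Nat.pos_of_ne_zero hl))).lt_or_eq with h' | h'
  · rw [Nat.mod_eq_of_lt h']
  · rw [show i % l + 1 = l from h', Nat.mod_self, h]

/-- A parameter with a cycle through `0` is integral. -/
theorem ValuationSubring.mem_of_cycle {K : Type*} [Field K] (A : ValuationSubring K) {p e n : ℕ}
    (he : 1 ≤ e) (hep : e < p) (hn : n ≠ 0) {c : K} {y : ℕ → K} (hy0 : y 0 = 0) (hyn : y n = 0)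
    (hy : ∀ i < n, y (i + 1) ^ p = y i ^ e - c) : c ∈ A := by
  by_contra hc
  rw [← A.valuation_le_one_iff, not_le] at hc
  have hlt : A.valuation c ^ e < A.valuation c ^ p := pow_lt_pow_right₀ hc hep
  have key : ∀ i ≤ n, A.valuation (y i) ^ p ≤ A.valuation c := by
    intro i hi
    induction i with
    | zero => simp [hy0, zero_pow (by omega : p ≠ 0)]
    | succ i ih =>
      rw [← map_pow, hy i hi]
      refine A.valuation.map_sub_le ?_ le_rfl
      have h := pow_le_pow_left₀ zero_le (ih (by omega)) e
      rw [pow_right_comm] at h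
      rw [map_pow]
      exact (lt_of_pow_lt_pow_left₀ p zero_le (h.trans_lt hlt)).le
  obtain ⟨m, rfl⟩ := Nat.exists_eq_succ_of_ne_zero hn
  have h := pow_le_pow_left₀ zero_le (key m (by omega)) e
  have hm := hy m (by omega)
  rw [hyn, zero_pow (by omega), eq_comm, sub_eq_zero] at hm
  rw [pow_right_comm, ← map_pow, hm] at h
  exact (h.trans_lt hlt).false

/-- A backward path from `0` with integral parameter is integral. -/
theorem ValuationSubring.mem_of_path {K : Type*} [Field K] (A : ValuationSubring K) {p e n : ℕ}
    (hp : p ≠ 0) {c : K} (hc : c ∈ A) {y : ℕ → K} (hy0 : y 0 = 0)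
    (hy : ∀ i < n, y (i + 1) ^ p = y i ^ e - c) : ∀ i ≤ n, y i ∈ A := by
  intro i hi
  induction i with
  | zero => exact hy0 ▸ A.zero_mem
  | succ i ih =>
    rw [← A.valuation_le_one_iff, ← pow_le_one_iff hp, ← map_pow, hy i hi,
      A.valuation_le_one_iff]
    exact sub_mem (pow_mem (ih (by omega)) e) hc

open IsLocalRing in
/-- In residue characteristic `p`, some parameter with nonzero residue has a cycle of length `n`
through `0`. -/
theorem ValuationSubring.exists_cycle {K : Type} [Field K] [IsAlgClosed K] (A : ValuationSubring K)
    {p e n : ℕ} [Fact p.Prime] [CharP (ResidueField A) p] (he : 1 ≤ e) (hep : e < p)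
    (hn : 2 ≤ n) :
    ∃ c : A, residue A c ≠ 0 ∧ ∃ y : ℕ → K, y 0 = 0 ∧ y n = 0 ∧
      ∀ i < n, y (i + 1) ^ p = y i ^ e - c := by
  obtain ⟨B, _, _, _, _, _, z, hz0, hz⟩ :=
    exists_free_backwardOrbit (R := A[X]) (p := p) (by omega) e X n
  set N := Algebra.norm A[X] (z n)
  have hroot : ∀ c : K, (N.map (algebraMap A K)).IsRoot c → ∃ y : ℕ → K, y 0 = 0 ∧ y n = 0 ∧
      ∀ i < n, y (i + 1) ^ p = y i ^ e - c := by
    intro c hc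
    let _ : Algebra A[X] K := (aeval c : A[X] →ₐ[A] K).toRingHom.toAlgebra
    obtain ⟨φ, hφ⟩ := exists_algHom_apply_eq_zero_of_norm (R := A[X]) (K := K) (b := z n) (by
      rw [IsRoot, eval_map_algebraMap] at hc
      exact hc)
    refine ⟨fun i ↦ φ (z i), by simp [hz0], hφ, fun i hi ↦ ?_⟩
    have hX : algebraMap A[X] K X = c := aeval_X c
    rw [← map_pow, hz i hi, map_sub, map_pow, AlgHom.commutes, hX]
  by_contra! hcon
  have hmem : ∀ c ∈ (N.map (algebraMap A K)).roots, c ∈ A := fun c hc ↦ by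
    obtain ⟨y, hy0, hyn, hy⟩ := hroot c (isRoot_of_mem_roots hc)
    exact A.mem_of_cycle he hep (by omega) hy0 hyn hy
  obtain ⟨s, hs⟩ : ∃ s : Multiset A, s.map (algebraMap A K) = (N.map (algebraMap A K)).roots :=
    ⟨(N.map (algebraMap A K)).roots.attach.map fun c ↦ ⟨c.1, hmem c.1 c.2⟩, by
      rw [Multiset.map_map]
      exact Multiset.attach_map_val _⟩
  have hs0 : ∀ c ∈ s, residue A c = 0 := by
    intro c hc
    by_contra h0
    obtain ⟨y, hy0, hyn, hy⟩ := hroot (algebraMap A K c)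
      (isRoot_of_mem_roots (hs ▸ Multiset.mem_map_of_mem _ hc))
    obtain ⟨i, hi, hne⟩ := hcon c h0 y hy0 hyn
    exact hne (hy i hi)
  have hinj : Function.Injective (algebraMap A K) := FaithfulSMul.algebraMap_injective A K
  have hN : N = C N.leadingCoeff * (s.map fun c ↦ X - C c).prod := by
    refine map_injective _ hinj ?_
    conv_lhs => rw [(IsAlgClosed.splits (N.map (algebraMap A K))).eq_prod_roots, ← hs,
      leadingCoeff_map_of_injective hinj]
    simp [Polynomial.map_multiset_prod, Multiset.map_map, Function.comp_def]
  have hNbar : N.map (residue A) = C (residue A N.leadingCoeff) * X ^ s.card := by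
    conv_lhs => rw [hN]
    have : s.map (fun c ↦ (X - C c).map (residue A)) = s.map fun _ ↦ X :=
      Multiset.map_congr rfl fun c hc ↦ by simp [hs0 c hc]
    simp [Polynomial.map_multiset_prod, Multiset.map_map] at this ⊢
    simp [this]
  obtain ⟨d, hd, hG⟩ := map_norm_pow_eq_backwardOrbit_pow (p := p) (mapRingHom (residue A)) hz0 hz
  obtain ⟨j, rfl⟩ := Nat.exists_eq_add_of_le' hn
  rw [coe_mapRingHom, hNbar, map_X, mul_pow, ← pow_mul, ← C_pow] at hG
  have ha : residue A N.leadingCoeff ^ p ^ (j + 2) ≠ 0 := fun h0 ↦ by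
    rw [h0, C_0, zero_mul] at hG
    exact pow_ne_zero d (backwardOrbit_succ_ne_zero he hep (j + 1)) hG.symm
  have hdvd : backwardOrbit p e (X : (ResidueField A)[X]) (j + 2) ∣
      X ^ (s.card * p ^ (j + 2)) :=
    (isUnit_C.mpr ha.isUnit).dvd_mul_left.mp (hG ▸ dvd_pow_self _ hd)
  obtain ⟨i, -, hi⟩ := (dvd_prime_pow prime_X _).mp hdvd
  exact not_associated_backwardOrbit he hep j i hi

open IsLocalRing in
/-- In residue characteristic `p`, backward paths are determined by their starting point, so a
parameter with nonzero residue has cycles through `0` of at most one prime length. -/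
theorem ValuationSubring.eq_of_cycle {K : Type*} [Field K] (A : ValuationSubring K)
    {p e m n : ℕ} [Fact p.Prime] [CharP (ResidueField A) p] (he : 1 ≤ e) (hm : m.Prime)
    (hn : n.Prime) {c : A} (hc : residue A c ≠ 0) {y z : ℕ → K}
    (hy0 : y 0 = 0) (hym : y m = 0) (hy : ∀ i < m, y (i + 1) ^ p = y i ^ e - c)
    (hz0 : z 0 = 0) (hzn : z n = 0) (hz : ∀ i < n, z (i + 1) ^ p = z i ^ e - c) : m = n := by
  by_contra hne
  have hp : p ≠ 0 := (Fact.out : p.Prime).ne_zero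
  have reduction : ∀ {l : ℕ} {x : ℕ → K}, l ≠ 0 → x 0 = 0 → x l = 0 →
      (∀ i < l, x (i + 1) ^ p = x i ^ e - c) → ∃ w : ℕ → ResidueField A, w 0 = 0 ∧
        (∀ i, w (i + 1) ^ p = w i ^ e - residue A c) ∧ ∀ i, w i = w (i % l) := by
    intro l x hl hx0 hxl hx
    have hmem := A.mem_of_path hp c.2 hx0 hx
    have hlt (i : ℕ) : i % l < l := Nat.mod_lt _ (by omega)
    refine ⟨fun i ↦ residue A ⟨x (i % l), hmem _ (hlt i).le⟩, ?_, fun i ↦ ?_, by simp⟩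
    · simp only [Nat.zero_mod, hx0]
      exact map_zero _
    · rw [← map_pow, ← map_pow, ← map_sub]
      refine congrArg _ (Subtype.ext ?_)
      have h := Nat.apply_add_one_mod hl (hx0.trans hxl.symm) i
      simpa [h] using hx _ (hlt i)
  obtain ⟨v, hv0, hv, hvm⟩ := reduction hm.ne_zero hy0 hym hy
  obtain ⟨w, hw0, hw, hwn⟩ := reduction hn.ne_zero hz0 hzn hz
  have hvw : ∀ i, v i = w i := by
    intro i
    induction i with
    | zero => rw [hv0, hw0]
    | succ i ih => exact frobenius_inj _ p (by simp only [frobenius_def, hv, hw, ih])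
  obtain ⟨k, hk0, hk1⟩ := Nat.chineseRemainder ((Nat.coprime_primes hm hn).mpr hne) 0 1
  have h1 : v 1 = 0 := by
    rw [hvw, hwn, ← hk1, ← hwn, ← hvw, hvm, hk0, ← hvm, hv0]
  have := hv 0
  rw [zero_add, h1, hv0, zero_pow hp, zero_pow (by omega), zero_sub, eq_comm, neg_eq_zero] at this
  exact hc this

/-- A field of characteristic zero has valuation rings of every prime residue characteristic. -/
theorem exists_valuationSubring_charP_residueField {K : Type*} [Field K] [CharZero K] {p : ℕ}
    (hp : p.Prime) : ∃ A : ValuationSubring K, CharP (IsLocalRing.ResidueField A) p := by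
  let Z : Subring K := (Int.castRingHom K).range
  have hI : Ideal.span {(p : Z)} ≠ ⊤ := by
    rw [Ne, Ideal.span_singleton_eq_top, isUnit_iff_exists_inv]
    rintro ⟨⟨_, a, rfl⟩, h⟩
    have h : (p : K) * a = 1 := congrArg Subtype.val h
    exact hp.not_dvd_one (by exact_mod_cast Dvd.intro a (by exact_mod_cast h : (p : ℤ) * a = 1))
  obtain ⟨A, -, hA⟩ := Ideal.image_subset_nonunits_valuationSubring _ hI
  refine ⟨A, (CharP.charP_iff_prime_eq_zero hp).mpr ?_⟩
  have : ((p : A) : K) ∈ A.nonunits := by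
    simpa using hA ⟨p, Ideal.mem_span_singleton_self _, rfl⟩
  rw [← map_natCast (IsLocalRing.residue A), IsLocalRing.residue_eq_zero_iff]
  exact A.coe_mem_nonunits_iff.mp this

/-- A backward cycle through `0` makes every critical point of `y ^ e = x ^ p + c` preperiodic. -/
theorem exists_preperiodic_path_of_cycle {p e n : ℕ} (hp : p ≠ 0) (he : 1 ≤ e) (hn : n ≠ 0)
    {c : ℂ} {y : ℕ → ℂ} (hy0 : y 0 = 0) (hyn : y n = 0)
    (hy : ∀ i < n, y (i + 1) ^ p = y i ^ e - c) (σ : ℂ)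
    (hσ : deriv (fun x : ℂ => x ^ p + c) σ = 0 ∨
      ∃ τ : ℂ, τ ^ e = σ ^ p + c ∧ deriv (fun y : ℂ => y ^ e) τ = 0) :
    ∃ x : ℕ → ℂ, x 0 = σ ∧ (∀ n, x (n + 1) ^ e = x n ^ p + c) ∧
      ∃ m n : ℕ, m < n ∧ ∀ k : ℕ, x (m + k) = x (n + k) := by
  let x : ℕ → ℂ := fun k ↦ y (n - k % n)
  have hx0 : x 0 = 0 := by simp [x, hyn]
  have hx : ∀ k, x (k + 1) ^ e = x k ^ p + c := by
    intro k
    have hlt := Nat.mod_lt k (Nat.pos_of_ne_zero hn)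
    have h := hy (n - k % n - 1) (by omega)
    have h1 : x (k + 1) = y (n - k % n - 1) :=
      Nat.apply_add_one_mod (x := fun i ↦ y (n - i)) hn (by simp [hy0, hyn]) k
    rw [h1, show x k = y (n - k % n - 1 + 1) by simp only [x]; congr 1; omega, h]
    ring
  have hper : ∀ k, x k = x (n + k) := fun k ↦ by simp [x]
  have hcase : σ = 0 ∨ σ ^ p + c = 0 := by
    rcases hσ with h | ⟨τ, hτ, h⟩
    · left
      have : (p : ℂ) * σ ^ (p - 1) = 0 := by simpa using h
      simp only [mul_eq_zero, Nat.cast_eq_zero, hp, false_or] at this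
      exact eq_zero_of_pow_eq_zero this
    · right
      have : (e : ℂ) * τ ^ (e - 1) = 0 := by simpa using h
      simp only [mul_eq_zero, Nat.cast_eq_zero, show e ≠ 0 by omega, false_or] at this
      rw [← hτ, eq_zero_of_pow_eq_zero this, zero_pow (by omega)]
  rcases hcase with rfl | h
  · exact ⟨x, hx0, hx, 0, n, by omega, fun k ↦ by rw [zero_add]; exact hper k⟩
  · refine ⟨fun k ↦ Nat.casesOn k σ x, rfl, fun k ↦ ?_, 1, n + 1, by omega, fun k ↦ ?_⟩
    · cases k with
      | zero => simp [hx0, h, zero_pow (by omega : e ≠ 0)]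
      | succ k => exact hx k
    · rw [add_comm 1, add_right_comm]
      exact hper k


theorem infinitely_many_PCC_unicritical (p e : ℕ) (hp : p.Prime) (he : 1 ≤ e) (hep : e < p) :
    { c : ℂ | ∀ σ : ℂ,
        (deriv (fun x : ℂ => x ^ p + c) σ = 0 ∨
          ∃ τ : ℂ, τ ^ e = σ ^ p + c ∧ deriv (fun y : ℂ => y ^ e) τ = 0) →
        ∃ x : ℕ → ℂ, x 0 = σ ∧ (∀ n, x (n + 1) ^ e = x n ^ p + c) ∧
          ∃ m n : ℕ, m < n ∧ ∀ k : ℕ, x (m + k) = x (n + k) }.Infinite := by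
  have := Fact.mk hp
  obtain ⟨A, _⟩ := exists_valuationSubring_charP_residueField (K := ℂ) hp
  choose c hc y hy0 hyn hy using fun n : Nat.Primes ↦ A.exists_cycle he hep n.2.two_le
  refine Set.infinite_of_injective_forall_mem (f := fun n ↦ (c n : ℂ)) (fun m n h ↦ ?_)
    fun n ↦ exists_preperiodic_path_of_cycle hp.ne_zero he n.2.ne_zero (hy0 n) (hyn n) (hy n)
  have hmn : c m = c n := Subtype.ext h
  exact Subtype.ext (A.eq_of_cycle he m.2 n.2 (hc m) (hy0 m) (hyn m) (hy m) (hy0 n) (hyn n)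
    (hmn ▸ hy n))
end

section
/- Let p be a prime, let e be an integer with 1 ≤ e < p, and let k be an algebraic closure of 𝔽_p. For all but finitely many integers n ≥ 1 there exists c ∈ k with the following two properties: (i) there is a finite sequence x_0, x_1, …, x_n ∈ k with x_0 = x_n = 0 and x_{i+1}^e = x_i^p + c for all 0 ≤ i < n; (ii) for every m with 1 ≤ m < n there is NO finite sequence y_0, y_1, …, y_m ∈ k with y_0 = y_m = 0 and y_{i+1}^e = y_i^p + c for all 0 ≤ i < m. -/
open Polynomial Function Filter

section CriticalPaths

variable {k : Type*} [Field k]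

/-- One backward step `y ↦ (y ^ e - c) ^ (1 / p)` along the correspondence `y ^ e = x ^ p + c`. -/
noncomputable def backwardStep (p e : ℕ) [ExpChar k p] [PerfectRing k p] (c y : k) : k :=
  (frobeniusEquiv k p).symm (y ^ e - c)

/-- The polynomial in `c` whose value is the `p ^ n`-th power of the `n`-th backward iterate of `0`
under the correspondence `y ^ e = x ^ p + c`. -/
noncomputable def criticalPoly (k : Type*) [Field k] (p e : ℕ) : ℕ → k[X]
  | 0 => 0
  | n + 1 => criticalPoly k p e n ^ e - X ^ p ^ n

theorem backwardStep_pow (p e : ℕ) [ExpChar k p] [PerfectRing k p] (c y : k) :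
    backwardStep p e c y ^ p = y ^ e - c :=
  frobenius_apply_frobeniusEquiv_symm k p _

theorem eq_backwardStep_iff {p e : ℕ} [ExpChar k p] [PerfectRing k p] {c x y : k} :
    x = backwardStep p e c y ↔ y ^ e = x ^ p + c := by
  rw [backwardStep, RingEquiv.eq_symm_apply, frobeniusEquiv_apply, frobenius_def, eq_sub_iff_add_eq,
    eq_comm]

theorem exists_path_iff_isPeriodicPt (p e : ℕ) [ExpChar k p] [PerfectRing k p] (c : k) (n : ℕ) :
    (∃ x : ℕ → k, x 0 = 0 ∧ x n = 0 ∧ ∀ i < n, x (i + 1) ^ e = x i ^ p + c) ↔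
      IsPeriodicPt (backwardStep p e c) n 0 := by
  constructor
  · rintro ⟨x, h0, hn, h⟩
    have key : ∀ j ≤ n, (backwardStep p e c)^[j] 0 = x (n - j) := by
      intro j
      induction j with
      | zero => simp [hn]
      | succ j ih =>
        intro hj
        rw [iterate_succ_apply', ih (by omega), eq_comm, eq_backwardStep_iff,
          ← h _ (by omega)]
        congr 2
        omega
    simpa [IsPeriodicPt, IsFixedPt, h0] using key n le_rfl
  · intro h
    refine ⟨fun i => (backwardStep p e c)^[n - i] 0, h, by simp, fun i hi => ?_⟩
    have hi' : n - i = (n - (i + 1)).succ := by omega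
    simp only [hi', iterate_succ_apply']
    exact eq_backwardStep_iff.1 rfl

theorem eval_criticalPoly (p e : ℕ) [hp : Fact p.Prime] [CharP k p] [PerfectRing k p]
    (c : k) (n : ℕ) :
    (criticalPoly k p e n).eval c = ((backwardStep p e c)^[n] 0) ^ p ^ n := by
  induction n with
  | zero => simp [criticalPoly]
  | succ n ih =>
    rw [criticalPoly, eval_sub, eval_pow, ih, iterate_succ_apply', pow_succ' p n, pow_mul,
      backwardStep_pow, sub_pow_char_pow, eval_pow, eval_X]
    ring

theorem isRoot_criticalPoly_iff (p e : ℕ) [hp : Fact p.Prime] [CharP k p] [PerfectRing k p]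
    (c : k) (n : ℕ) :
    (criticalPoly k p e n).IsRoot c ↔ IsPeriodicPt (backwardStep p e c) n 0 := by
  rw [IsRoot, eval_criticalPoly, pow_eq_zero_iff (pow_ne_zero _ hp.out.ne_zero)]
  rfl

theorem natDegree_criticalPoly_succ {p e : ℕ} (he : e ≠ 0) (hep : e < p) (n : ℕ) :
    (criticalPoly k p e (n + 1)).natDegree = p ^ n := by
  induction n with
  | zero => simp [criticalPoly, he]
  | succ n ih =>
    rw [criticalPoly, natDegree_sub_eq_right_of_natDegree_lt, natDegree_X_pow]
    rw [natDegree_X_pow, natDegree_pow, ih, pow_succ']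
    exact Nat.mul_lt_mul_of_pos_right hep (pow_pos (by omega) _)

theorem criticalPoly_succ_ne_zero {p e : ℕ} (he : e ≠ 0) (hep : e < p) (n : ℕ) :
    criticalPoly k p e (n + 1) ≠ 0 := by
  apply ne_zero_of_natDegree_gt (n := 0)
  rw [natDegree_criticalPoly_succ he hep]
  exact pow_pos (by omega) _

theorem derivative_criticalPoly_one {p e : ℕ} (he : e ≠ 0) :
    derivative (criticalPoly k p e 1) = -1 := by
  simp [criticalPoly, he]

theorem derivative_criticalPoly_add_two (p e : ℕ) [CharP k p] (n : ℕ) :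
    derivative (criticalPoly k p e (n + 2)) =
      C (e : k) * criticalPoly k p e (n + 1) ^ (e - 1) *
        derivative (criticalPoly k p e (n + 1)) := by
  rw [criticalPoly]
  simp [derivative_pow]

theorem natCast_ne_zero_of_lt_char {p e : ℕ} [CharP k p] (he : e ≠ 0) (hep : e < p) :
    (e : k) ≠ 0 := by
  rw [Ne, CharP.cast_eq_zero_iff k p]
  exact Nat.not_dvd_of_pos_of_lt (by omega) hep

theorem derivative_criticalPoly_succ_ne_zero {p e : ℕ} [CharP k p] (he : e ≠ 0) (hep : e < p)
    (n : ℕ) : derivative (criticalPoly k p e (n + 1)) ≠ 0 := by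
  induction n with
  | zero => simp [derivative_criticalPoly_one he]
  | succ n ih =>
    rw [derivative_criticalPoly_add_two]
    exact mul_ne_zero (mul_ne_zero (C_ne_zero.2 (natCast_ne_zero_of_lt_char he hep))
      (pow_ne_zero _ (criticalPoly_succ_ne_zero he hep n))) ih

theorem rootMultiplicity_derivative_criticalPoly_add_two {p e : ℕ} [CharP k p] (he : e ≠ 0)
    (hep : e < p) (c : k) (n : ℕ) :
    (derivative (criticalPoly k p e (n + 2))).rootMultiplicity c =
      (e - 1) * (criticalPoly k p e (n + 1)).rootMultiplicity c +
        (derivative (criticalPoly k p e (n + 1))).rootMultiplicity c := by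
  classical
  have h := derivative_criticalPoly_succ_ne_zero (k := k) he hep (n + 1)
  rw [derivative_criticalPoly_add_two] at h ⊢
  rw [rootMultiplicity_mul h, rootMultiplicity_mul (left_ne_zero_of_mul h), rootMultiplicity_C,
    zero_add, ← count_roots, roots_pow, Multiset.count_nsmul, count_roots]

theorem rootMultiplicity_derivative_criticalPoly_lt {p e : ℕ} [CharP k p] (he : e ≠ 0)
    (hep : e < p) (c : k) (m : ℕ)
    (hm : ∀ n, (criticalPoly k p e n).IsRoot c → m ∣ n) (n : ℕ) :
    (derivative (criticalPoly k p e (n + 1))).rootMultiplicity c + 1 ≤ e ^ (n / m) := by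
  induction n with
  | zero => simp [derivative_criticalPoly_one he, ← C_1, ← C_neg, rootMultiplicity_C,
      -map_neg, -map_one]
  | succ n ih =>
    rw [rootMultiplicity_derivative_criticalPoly_add_two he hep, Nat.succ_div]
    split_ifs with hd
    · have h1 := rootMultiplicity_sub_one_le_derivative_rootMultiplicity_of_ne_zero _ c
        (derivative_criticalPoly_succ_ne_zero (k := k) he hep n)
      obtain ⟨d, rfl⟩ := Nat.exists_eq_succ_of_ne_zero he
      rw [pow_succ, Nat.succ_sub_one]
      have h2 := Nat.sub_le_iff_le_add.1 h1
      nlinarith [Nat.mul_le_mul_left d h2]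
    · rw [rootMultiplicity_eq_zero (fun h => hd (hm _ h))]
      simpa using ih

theorem rootMultiplicity_criticalPoly_le {p e : ℕ} [CharP k p] (he : e ≠ 0)
    (hep : e < p) (c : k) (m : ℕ)
    (hm : ∀ n, (criticalPoly k p e n).IsRoot c → m ∣ n) (n : ℕ) :
    (criticalPoly k p e (n + 1)).rootMultiplicity c ≤ e ^ (n / m) :=
  (Nat.sub_le_iff_le_add.1 (rootMultiplicity_sub_one_le_derivative_rootMultiplicity_of_ne_zero _ c
    (derivative_criticalPoly_succ_ne_zero he hep n))).trans
    (rootMultiplicity_derivative_criticalPoly_lt he hep c m hm n)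

/-- If no parameter has exact critical period `n + 1`, the roots of `criticalPoly k p e (n + 1)`
are few and of small multiplicity. -/
theorem pow_le_of_forall_minimalPeriod_ne [IsAlgClosed k] {p e : ℕ} [hp : Fact p.Prime]
    [CharP k p] [PerfectRing k p] (he : e ≠ 0) (hep : e < p) (n : ℕ)
    (h : ∀ c : k, minimalPeriod (backwardStep p e c) 0 ≠ n + 1) :
    p ^ n ≤ e ^ n + p ^ ((n + 1) / 2) * e ^ ((n + 1) / 2) := by
  classical
  set N := (n + 1) / 2
  set f := criticalPoly k p e (n + 1)
  have hdvd (c : k) (j : ℕ) (hj : (criticalPoly k p e j).IsRoot c) :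
      minimalPeriod (backwardStep p e c) 0 ∣ j :=
    ((isRoot_criticalPoly_iff p e c j).1 hj).minimalPeriod_dvd
  let T : Finset k := (Finset.range N).biUnion fun j => (criticalPoly k p e (j + 1)).roots.toFinset
  have hT : T.card ≤ p ^ N := by
    refine Finset.card_biUnion_le.trans (le_trans (Finset.sum_le_sum (g := fun j => p ^ j) ?_) ?_)
    · intro j _
      rw [← natDegree_criticalPoly_succ (k := k) he hep j]
      exact (Multiset.toFinset_card_le _).trans (card_roots' _)
    · exact (Nat.geomSum_lt hp.out.two_le (by simp)).le
  have hroot (c : k) (hc : c ∈ f.roots.toFinset) (hc0 : c ≠ 0) :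
      2 ≤ minimalPeriod (backwardStep p e c) 0 ∧ c ∈ T := by
    have hc' : f.IsRoot c := isRoot_of_mem_roots (Multiset.mem_toFinset.1 hc)
    have hper := (isRoot_criticalPoly_iff p e c _).1 hc'
    obtain ⟨d, hd⟩ := hper.minimalPeriod_dvd
    have hne := h c
    have hroot := (isRoot_criticalPoly_iff p e c _).2
      (isPeriodicPt_minimalPeriod (backwardStep p e c) 0)
    set m := minimalPeriod (backwardStep p e c) 0
    have hm0 : m ≠ 0 := by rintro h0; simp [h0] at hd
    have hm1 : m ≠ 1 := by
      intro h1
      rw [h1] at hroot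
      simp [criticalPoly, he, hc0] at hroot
    have hd2 : 2 ≤ d := by
      by_contra! hlt
      interval_cases d <;> omega
    refine ⟨by omega, Finset.mem_biUnion.2 ⟨m - 1, Finset.mem_range.2 ?_, ?_⟩⟩
    · have : m * 2 ≤ n + 1 := hd ▸ Nat.mul_le_mul_left m hd2
      omega
    · rw [Multiset.mem_toFinset, mem_roots (criticalPoly_succ_ne_zero he hep _)]
      rwa [Nat.sub_add_cancel (by omega)]
  calc p ^ n = f.roots.card := by
        rw [splits_iff_card_roots.1 (IsAlgClosed.splits f), natDegree_criticalPoly_succ he hep]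
    _ = ∑ c ∈ f.roots.toFinset, f.roots.count c := (Multiset.toFinset_sum_count_eq _).symm
    _ ≤ ∑ c ∈ insert 0 (f.roots.toFinset.erase 0), f.roots.count c :=
        Finset.sum_le_sum_of_subset (fun c hc => by
          by_cases hc0 : c = 0 <;> simp_all)
    _ = f.roots.count 0 + ∑ c ∈ f.roots.toFinset.erase 0, f.roots.count c :=
        Finset.sum_insert (by simp)
    _ ≤ e ^ n + (f.roots.toFinset.erase 0).card * e ^ N := by
        gcongr
        · rw [count_roots]
          exact (rootMultiplicity_criticalPoly_le he hep 0 1 (by simp) n).trans (by simp)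
        · rw [← smul_eq_mul]
          refine Finset.sum_le_card_nsmul _ _ _ fun c hc => ?_
          rw [Finset.mem_erase] at hc
          rw [count_roots]
          refine (rootMultiplicity_criticalPoly_le he hep c _ (hdvd c) n).trans
            (Nat.pow_le_pow_right (by omega) ?_)
          exact (Nat.div_le_div_left (hroot c hc.2 hc.1).1 two_pos).trans
            (Nat.div_le_div_right n.le_succ)
    _ ≤ e ^ n + p ^ N * e ^ N := by
        gcongr
        refine (Finset.card_le_card fun c hc => ?_).trans hT
        rw [Finset.mem_erase] at hc
        exact (hroot c hc.2 hc.1).2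

end CriticalPaths

theorem eventually_pow_add_pow_mul_pow_lt_pow {p e : ℕ} (hep : e < p) :
    ∀ᶠ n : ℕ in atTop, e ^ n + p ^ ((n + 1) / 2) * e ^ ((n + 1) / 2) < p ^ n := by
  have hp : (0 : ℝ) < p := by exact_mod_cast (by omega : 0 < p)
  have hr : Tendsto (fun n : ℕ => ((e : ℝ) / p) ^ n) atTop (nhds 0) :=
    tendsto_pow_atTop_nhds_zero_of_lt_one (by positivity)
      ((div_lt_one hp).2 (by exact_mod_cast hep))
  have hhalf : Tendsto (fun n : ℕ => (n + 1) / 2) atTop atTop :=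
    tendsto_atTop.2 fun b => eventually_atTop.2 ⟨2 * b, fun n hn => by omega⟩
  have hsum := hr.add ((hr.comp hhalf).const_mul (p : ℝ))
  rw [mul_zero, add_zero] at hsum
  filter_upwards [hsum.eventually_lt_const one_pos] with n hn
  simp only [comp_apply, div_pow] at hn
  set N := (n + 1) / 2
  have hN : (p : ℝ) ^ N * p ^ N ≤ p ^ n * p := by
    rw [← pow_add, ← pow_succ]
    exact pow_le_pow_right₀ (by exact_mod_cast (by omega : 1 ≤ p)) (by omega)
  have hle : (p : ℝ) ^ N * e ^ N ≤ p ^ n * (p * (e ^ N / p ^ N)) := by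
    rw [← mul_assoc, mul_div_assoc', le_div_iff₀ (by positivity)]
    nlinarith [pow_nonneg (Nat.cast_nonneg (α := ℝ) e) N]
  have hmul := mul_lt_mul_of_pos_left hn (pow_pos hp n)
  rw [mul_add, mul_div_cancel₀ _ (pow_pos hp n).ne', mul_one] at hmul
  exact_mod_cast (add_le_add_right hle ((e : ℝ) ^ n)).trans_lt hmul

theorem exists_exact_period_critical_path_charP (p e : ℕ) [hp : Fact p.Prime]
    (he : 1 ≤ e) (hep : e < p) :
    { n : ℕ | 1 ≤ n ∧ ¬ ∃ c : AlgebraicClosure (ZMod p),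
        (∃ x : ℕ → AlgebraicClosure (ZMod p), x 0 = 0 ∧ x n = 0 ∧
          ∀ i < n, x (i + 1) ^ e = x i ^ p + c) ∧
        (∀ m : ℕ, 1 ≤ m → m < n →
          ¬ ∃ y : ℕ → AlgebraicClosure (ZMod p), y 0 = 0 ∧ y m = 0 ∧
            ∀ i < m, y (i + 1) ^ e = y i ^ p + c) }.Finite := by
  have : CharP (AlgebraicClosure (ZMod p)) p := charP_of_injective_algebraMap' (ZMod p) p
  obtain ⟨B, hB⟩ := eventually_atTop.1 (eventually_pow_add_pow_mul_pow_lt_pow hep)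
  refine (Set.finite_Iic B).subset ?_
  rintro n ⟨hn1, hn⟩
  simp only [exists_path_iff_isPeriodicPt] at hn
  obtain ⟨n, rfl⟩ := Nat.exists_eq_add_of_le' hn1
  rw [Set.mem_Iic]
  by_contra! hlt
  refine (hB n (by omega)).not_ge (pow_le_of_forall_minimalPeriod_ne
    (k := AlgebraicClosure (ZMod p)) (by omega) hep n fun c hc => hn ⟨c, ?_, fun m hm hmn h => ?_⟩)
  · rw [← hc]
    exact isPeriodicPt_minimalPeriod _ _
  · have := h.minimalPeriod_le hm
    omega
end

section
/- Let d ≥ 2, let R be the localization of ℤ at the multiplicative set generated by the integers 2, 3, …, d, and let S = R[s_1, …, s_{d−1}] be the polynomial ring in d−1 variables. Define f_s(x) = Σ_{i=1}^{d} ((−1)^{d−i}/i)·σ_{d−i}(s_1, …, s_{d−1})·x^i ∈ S[x], where σ_k denotes the k-th elementary symmetric polynomial in s_1, …, s_{d−1} (with σ_0 = 1), and set F_j = f_s(s_j) ∈ S for 1 ≤ j ≤ d−1. Then there exist an integer D ≥ d and polynomials A_{ij} ∈ S, each homogeneous of degree D − d, such that s_i^D = Σ_{j=1}^{d−1} A_{ij}·F_j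 for every 1 ≤ i ≤ d−1. -/
open Polynomial

/-- The localization of `ℤ` at the multiplicative set generated by `2, 3, …, d`. -/
abbrev Rloc (d : ℕ) : Type :=
  Localization (Submonoid.closure { x : ℤ | ∃ i : ℕ, 2 ≤ i ∧ i ≤ d ∧ x = (i : ℤ) })

noncomputable instance (d : ℕ) : CommRing (Rloc d) := inferInstance

/-- If a polynomial of degree at most `n + 1` vanishes at `0` and at all `n` roots of its
derivative, then these roots are all `0`, provided `1, …, n + 1` are nonzero in the field. -/
theorem eq_zero_of_derivative_eq_prod_X_sub_C {K σ : Type*} [Field K] [Fintype σ] (a : σ → K)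
    (f : K[X]) (hdeg : f.natDegree ≤ Fintype.card σ + 1)
    (hcast : ∀ k : ℕ, 1 ≤ k → k ≤ Fintype.card σ + 1 → (k : K) ≠ 0)
    (h0 : f.IsRoot 0) (hf' : derivative f = ∏ i, (X - C (a i)))
    (hroot : ∀ i, f.IsRoot (a i)) (i : σ) : a i = 0 := by
  classical
  by_contra hi
  have hf'0 : derivative f ≠ 0 := by
    rw [hf']
    exact (monic_prod_of_monic _ _ fun i _ => monic_X_sub_C (a i)).ne_zero
  have hf0 : f ≠ 0 := by
    rintro rfl
    simp at hf'0
  have hroots' : (derivative f).roots = Finset.univ.val.map a := by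
    rw [hf', roots_prod _ _ (hf' ▸ hf'0)]
    simp
  set T : Finset K := insert 0 (Finset.univ.image a) with hT
  have hTroot : ∀ b ∈ T, f.IsRoot b := by
    intro b hb
    simp only [hT, Finset.mem_insert, Finset.mem_image, Finset.mem_univ, true_and] at hb
    rcases hb with rfl | ⟨j, rfl⟩
    exacts [h0, hroot j]
  have hmult : ∀ b ∈ T, f.roots.count b = (derivative f).roots.count b + 1 := by
    intro b hb
    have hpos := (rootMultiplicity_pos hf0).2 (hTroot b hb)
    have hle : f.rootMultiplicity b ≤ f.natDegree :=
      count_roots f (a := b) ▸ (Multiset.count_le_card _ _).trans (card_roots' f)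
    rw [count_roots, count_roots, derivative_rootMultiplicity_of_root_of_mem_nonZeroDivisors
      (hTroot b hb) (mem_nonZeroDivisors_of_ne_zero (hcast _ hpos (hle.trans hdeg)))]
    omega
  have hsum' : ∑ b ∈ T, (derivative f).roots.count b = Fintype.card σ := by
    rw [Multiset.sum_count_eq_card, hroots']
    · simp
    · intro b hb
      rw [hroots'] at hb
      simp only [Multiset.mem_map, Finset.mem_val, Finset.mem_univ, true_and] at hb
      obtain ⟨j, rfl⟩ := hb
      simp [hT]
  have hsum : ∑ b ∈ T, f.roots.count b ≤ f.natDegree := by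
    refine le_trans ?_ (card_roots' f)
    rw [← Multiset.toFinset_sum_count_eq]
    refine Finset.sum_le_sum_of_subset fun b hb => ?_
    rw [Multiset.mem_toFinset, mem_roots hf0]
    exact hTroot b hb
  have hcard : 2 ≤ T.card := by
    rw [← Finset.card_pair (Ne.symm hi)]
    refine Finset.card_le_card fun b hb => ?_
    simp only [Finset.mem_insert, Finset.mem_singleton] at hb
    rcases hb with rfl | rfl <;> simp [hT]
  rw [Finset.sum_congr rfl hmult, Finset.sum_add_distrib, hsum', Finset.sum_const,
    smul_eq_mul, mul_one] at hsum
  omega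

theorem MvPolynomial.isHomogeneous_coeff_prod_X_sub_C_X {σ R : Type*} [CommRing R]
    (s : Finset σ) (k n : ℕ) (h : n + k = s.card) :
    ((∏ i ∈ s, (Polynomial.X - Polynomial.C (X i : MvPolynomial σ R))).coeff k).IsHomogeneous
      n := by
  classical
  induction s using Finset.induction_on generalizing k n with
  | empty =>
    obtain ⟨rfl, rfl⟩ : n = 0 ∧ k = 0 := by simpa using h
    simpa using isHomogeneous_one σ R
  | insert a s ha ih =>
    rw [Finset.card_insert_of_notMem ha] at h
    rw [Finset.prod_insert ha, sub_mul, Polynomial.coeff_sub, Polynomial.coeff_C_mul]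
    refine IsHomogeneous.sub ?_ ?_
    · cases k with
      | zero => simpa using isHomogeneous_zero σ R n
      | succ k =>
        rw [Polynomial.coeff_X_mul]
        exact ih k n (by omega)
    · cases n with
      | zero =>
        rw [Polynomial.coeff_eq_zero_of_natDegree_lt, mul_zero]
        · exact isHomogeneous_zero σ R 0
        · rw [Polynomial.natDegree_prod_of_monic _ _ fun i _ => Polynomial.monic_X_sub_C _]
          cases subsingleton_or_nontrivial R
          · simp [Polynomial.natDegree_of_subsingleton]; omega
          · simp; omega
      | succ n =>
        rw [add_comm n 1]
        exact (isHomogeneous_X R a).mul (ih k n (by omega))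

theorem MvPolynomial.homogeneousComponent_mul_of_isHomogeneous_right {σ R : Type*}
    [CommSemiring R] {p q : MvPolynomial σ R} {m n : ℕ} (hq : q.IsHomogeneous m) (h : m ≤ n) :
    homogeneousComponent n (p * q) = homogeneousComponent (n - m) p * q := by
  classical
  let := gradedAlgebra (σ := σ) (R := R)
  simp only [← decomposition.decompose'_apply]
  exact DirectSum.coe_decompose_mul_of_right_mem_of_le (homogeneousSubmodule σ R) hq h

theorem MvPolynomial.exists_homogeneous_sum_eq_of_mem_span {σ ι R : Type*} [Fintype ι]
    [CommSemiring R] {p : MvPolynomial σ R} {g : ι → MvPolynomial σ R} {m n : ℕ}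
    (hp : p.IsHomogeneous n) (hg : ∀ j, (g j).IsHomogeneous m) (h : m ≤ n)
    (hmem : p ∈ Ideal.span (Set.range g)) :
    ∃ A : ι → MvPolynomial σ R, (∀ j, (A j).IsHomogeneous (n - m)) ∧ p = ∑ j, A j * g j := by
  obtain ⟨B, hB⟩ := Ideal.mem_span_range_iff_exists_fun.1 hmem
  refine ⟨fun j => homogeneousComponent (n - m) (B j),
    fun j => homogeneousComponent_isHomogeneous _ _, ?_⟩
  rw [← homogeneousComponent_eq_self hp, ← hB, map_sum]
  exact Finset.sum_congr rfl fun j _ => homogeneousComponent_mul_of_isHomogeneous_right (hg j) h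

section CriticalValues

variable {σ R : Type*} [Fintype σ] [CommRing R] {F : Polynomial (MvPolynomial σ R)}

theorem natDegree_le_of_derivative_eq_prod_X_sub_C [IsDomain R] [CharZero R]
    (hF' : derivative F = ∏ i, (X - C (MvPolynomial.X i))) :
    F.natDegree ≤ Fintype.card σ + 1 := by
  have h : (derivative F).natDegree = Fintype.card σ := by
    rw [hF', natDegree_prod_of_monic _ _ fun i _ => monic_X_sub_C _]
    simp
  rw [natDegree_derivative] at h
  omega

theorem isHomogeneous_eval_of_derivative_eq_prod_X_sub_C
    (hcast : ∀ k : ℕ, 1 ≤ k → k ≤ Fintype.card σ + 1 → IsUnit (k : R))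
    (hdeg : F.natDegree ≤ Fintype.card σ + 1) (hF0 : F.eval 0 = 0)
    (hF' : derivative F = ∏ i, (X - C (MvPolynomial.X i))) (j : σ) :
    (F.eval (MvPolynomial.X j)).IsHomogeneous (Fintype.card σ + 1) := by
  rw [eval_eq_sum_range' (Nat.lt_succ_of_le hdeg)]
  refine MvPolynomial.IsHomogeneous.sum _ _ _ fun k hk => ?_
  rw [Finset.mem_range] at hk
  cases k with
  | zero =>
    rw [coeff_zero_eq_eval_zero, hF0, zero_mul]
    exact MvPolynomial.isHomogeneous_zero _ _ _
  | succ k =>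
    obtain ⟨u, hu⟩ := hcast (k + 1) (by omega) (by omega)
    have hcoeff : F.coeff (k + 1) = (derivative F).coeff k * MvPolynomial.C (↑u⁻¹ : R) := by
      have hu' : ((k : MvPolynomial σ R) + 1) = MvPolynomial.C (u : R) := by
        rw [hu]; simp
      rw [coeff_derivative, hu', mul_assoc, ← map_mul, Units.mul_inv, map_one, mul_one]
    have hhom : (F.coeff (k + 1)).IsHomogeneous (Fintype.card σ - k) := by
      rw [hcoeff, hF']
      exact (MvPolynomial.isHomogeneous_coeff_prod_X_sub_C_X Finset.univ k
        (Fintype.card σ - k) (by rw [Finset.card_univ]; omega)).mul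
          (MvPolynomial.isHomogeneous_C _ _)
    convert hhom.mul (MvPolynomial.isHomogeneous_X_pow (R := R) j (k + 1)) using 1
    omega

theorem X_mem_radical_span_of_derivative_eq_prod_X_sub_C
    (hcast : ∀ k : ℕ, 1 ≤ k → k ≤ Fintype.card σ + 1 → IsUnit (k : R))
    (hdeg : F.natDegree ≤ Fintype.card σ + 1) (hF0 : F.eval 0 = 0)
    (hF' : derivative F = ∏ i, (X - C (MvPolynomial.X i))) (i : σ) :
    (MvPolynomial.X i : MvPolynomial σ R) ∈
      (Ideal.span (Set.range fun j => F.eval (MvPolynomial.X j))).radical := by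
  rw [Ideal.radical_eq_sInf, Submodule.mem_sInf]
  rintro P ⟨hP, hPprime⟩
  let φ : MvPolynomial σ R →+* FractionRing (MvPolynomial σ R ⧸ P) :=
    (algebraMap (MvPolynomial σ R ⧸ P) _).comp (Ideal.Quotient.mk P)
  have hφ : ∀ p, φ p = 0 ↔ p ∈ P := fun p => by
    simp [φ, Ideal.Quotient.eq_zero_iff_mem]
  rw [← hφ]
  refine eq_zero_of_derivative_eq_prod_X_sub_C (fun j => φ (MvPolynomial.X j)) (F.map φ)
    (natDegree_map_le.trans hdeg) (fun k hk hk' => ?_) ?_ ?_ (fun j => ?_) i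
  · simpa using ((hcast k hk hk').map (φ.comp MvPolynomial.C)).ne_zero
  · rw [IsRoot, ← map_zero φ, eval_map_apply, hF0, map_zero]
  · rw [derivative_map, hF', Polynomial.map_prod]
    simp
  · rw [IsRoot, eval_map_apply, hφ]
    exact hP (Ideal.subset_span ⟨j, rfl⟩)

theorem exists_homogeneous_X_pow_eq_sum_mul_eval [IsDomain R] [CharZero R]
    (hcast : ∀ k : ℕ, 1 ≤ k → k ≤ Fintype.card σ + 1 → IsUnit (k : R))
    (hF0 : F.eval 0 = 0) (hF' : derivative F = ∏ i, (X - C (MvPolynomial.X i))) :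
    ∃ D : ℕ, Fintype.card σ + 1 ≤ D ∧ ∃ A : σ → σ → MvPolynomial σ R,
      (∀ i j, (A i j).IsHomogeneous (D - (Fintype.card σ + 1))) ∧
      ∀ i, (MvPolynomial.X i : MvPolynomial σ R) ^ D =
        ∑ j, A i j * F.eval (MvPolynomial.X j) := by
  have hdeg := natDegree_le_of_derivative_eq_prod_X_sub_C hF'
  choose N hN using X_mem_radical_span_of_derivative_eq_prod_X_sub_C hcast hdeg hF0 hF'
  let D := Finset.univ.sup N + (Fintype.card σ + 1)
  have key : ∀ i, ∃ A : σ → MvPolynomial σ R,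
      (∀ j, (A j).IsHomogeneous (D - (Fintype.card σ + 1))) ∧
      (MvPolynomial.X i : MvPolynomial σ R) ^ D = ∑ j, A j * F.eval (MvPolynomial.X j) :=
    fun i => MvPolynomial.exists_homogeneous_sum_eq_of_mem_span
      (MvPolynomial.isHomogeneous_X_pow i D)
      (isHomogeneous_eval_of_derivative_eq_prod_X_sub_C hcast hdeg hF0 hF')
      (Nat.le_add_left _ _)
      (Ideal.pow_mem_of_pow_mem _ (hN i)
        ((Finset.le_sup (Finset.mem_univ i)).trans (Nat.le_add_right _ _)))
  choose A hA hA' using key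
  exact ⟨D, Nat.le_add_left _ _, A, hA, hA'⟩

end CriticalValues

theorem closure_natCast_le_nonZeroDivisors (d : ℕ) :
    Submonoid.closure { x : ℤ | ∃ i : ℕ, 2 ≤ i ∧ i ≤ d ∧ x = (i : ℤ) } ≤ nonZeroDivisors ℤ := by
  rw [Submonoid.closure_le]
  rintro x ⟨i, hi, -, rfl⟩
  exact mem_nonZeroDivisors_of_ne_zero (by positivity)

theorem Rloc.isDomain (d : ℕ) : IsDomain (Rloc d) :=
  IsLocalization.isDomain_localization (closure_natCast_le_nonZeroDivisors d)

theorem Rloc.charZero (d : ℕ) : CharZero (Rloc d) :=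
  charZero_of_injective_algebraMap
    (IsLocalization.injective (Rloc d) (closure_natCast_le_nonZeroDivisors d))

theorem Rloc.isUnit_natCast {d k : ℕ} (hk : 1 ≤ k) (hkd : k ≤ d) : IsUnit (k : Rloc d) := by
  obtain rfl | hk := hk.eq_or_lt
  · simp
  · simpa using IsLocalization.map_units (Rloc d)
      (⟨(k : ℤ), Submonoid.subset_closure ⟨k, hk, hkd, rfl⟩⟩ :
        Submonoid.closure { x : ℤ | ∃ i : ℕ, 2 ≤ i ∧ i ≤ d ∧ x = (i : ℤ) })

/-- Nullstellensatz lemma: let `S = R[s_1, …, s_{d-1}]` and let `F = f_s(x) ∈ S[x]` be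
the (unique) polynomial with zero constant term whose derivative is `∏ (x - s_i)`.
Then there is `D ≥ d` such that each power `s_i^D` lies in the ideal generated by the
values `F_j = f_s(s_j)`, with homogeneous coefficients of degree `D - d`. -/
theorem nullstellensatz_lemma (d : ℕ) (hd : 2 ≤ d)
    (F : Polynomial (MvPolynomial (Fin (d - 1)) (Rloc d)))
    (hF0 : F.eval 0 = 0)
    (hF' : derivative F =
      ∏ i : Fin (d - 1),
        ((X : Polynomial (MvPolynomial (Fin (d - 1)) (Rloc d))) -
          C (MvPolynomial.X i : MvPolynomial (Fin (d - 1)) (Rloc d)))) :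
    ∃ D : ℕ, d ≤ D ∧
      ∃ A : Fin (d - 1) → Fin (d - 1) → MvPolynomial (Fin (d - 1)) (Rloc d),
        (∀ i j, (A i j).IsHomogeneous (D - d)) ∧
        ∀ i : Fin (d - 1),
          (MvPolynomial.X i : MvPolynomial (Fin (d - 1)) (Rloc d)) ^ D =
            ∑ j : Fin (d - 1), A i j * F.eval (MvPolynomial.X j) := by
  have := Rloc.isDomain d
  have := Rloc.charZero d
  have hcard : Fintype.card (Fin (d - 1)) + 1 = d := by
    rw [Fintype.card_fin]
    omega
  have h := exists_homogeneous_X_pow_eq_sum_mul_eval (R := Rloc d)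
    (fun k hk hkd => Rloc.isUnit_natCast hk (hkd.trans hcard.le)) hF0 hF'
  rwa [hcard] at h
end

section
/- Let K be a field equipped with an absolute value |·| : K → ℝ, and let f, g ∈ K[x] with deg f = d > deg g = e ≥ 1. Then: (a) for every path x for the correspondence g(y) = f(x), the limit G(x) := lim_{n→∞} (e/d)^n · log⁺|x_n| exists; (b) there is a real constant κ ≥ 0, depending only on f, g and |·| (and not on the path), such that every path x satisfies |G(x) − log⁺|x_0|| ≤ κ. -/
open Filter

namespace Polynomial

variable {K : Type*} [Field K] (v : AbsoluteValue K ℝ)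

/-- A polynomial of degree at most `n` is bounded by a constant times `max 1 |x| ^ n`. -/
theorem exists_absoluteValue_eval_le (p : Polynomial K) (n : ℕ) (hn : p.natDegree ≤ n) :
    ∃ A : ℝ, 0 ≤ A ∧ ∀ x : K, v (p.eval x) ≤ A * max 1 (v x) ^ n := by
  refine ⟨∑ i ∈ Finset.range (n + 1), v (p.coeff i),
    Finset.sum_nonneg fun i _ => v.nonneg _, fun x => ?_⟩
  rw [eval_eq_sum_range' (Nat.lt_succ_of_le hn), Finset.sum_mul]
  refine (v.sum_le _ _).trans (Finset.sum_le_sum fun i hi => ?_)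
  rw [v.map_mul, v.map_pow]
  refine mul_le_mul_of_nonneg_left ?_ (v.nonneg _)
  exact (pow_le_pow_left₀ (v.nonneg x) (le_max_right _ _) i).trans
    (pow_le_pow_right₀ (le_max_left _ _) (Nat.lt_succ_iff.mp (Finset.mem_range.mp hi)))

/-- `log⁺ |p(x)|` exceeds `deg p * log⁺ |x|` by at most a constant. -/
theorem exists_posLog_eval_le (p : Polynomial K) :
    ∃ C : ℝ, ∀ x : K,
      Real.posLog (v (p.eval x)) ≤ p.natDegree * Real.posLog (v x) + C := by
  obtain ⟨A, hA, h⟩ := exists_absoluteValue_eval_le v p _ le_rfl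
  refine ⟨Real.posLog A, fun x => ?_⟩
  have hM : Real.posLog (max 1 (v x)) = Real.posLog (v x) := by
    rw [Real.posLog_eq_log_max_one (v.nonneg x), Real.posLog_eq_log_max_one (by positivity),
      max_eq_right (le_max_left _ _)]
  have := (Real.posLog_le_posLog (v.nonneg _) (h x)).trans Real.posLog_mul
  rw [Real.posLog_pow, hM] at this
  linarith

/-- `deg p * log⁺ |x|` exceeds `log⁺ |p(x)|` by at most a constant. -/
theorem exists_le_posLog_eval (p : Polynomial K) :
    ∃ C : ℝ, ∀ x : K,
      p.natDegree * Real.posLog (v x) ≤ Real.posLog (v (p.eval x)) + C := by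
  rcases Nat.eq_zero_or_pos p.natDegree with h0 | hpos
  · exact ⟨0, fun x => by simpa [h0] using Real.posLog_nonneg⟩
  obtain ⟨m, hm⟩ : ∃ m, p.natDegree = m + 1 := ⟨_, (Nat.succ_pred_eq_of_pos hpos).symm⟩
  obtain ⟨B, hB, h⟩ := exists_absoluteValue_eval_le v p.eraseLead m
    (by have := p.eraseLead_natDegree_le; omega)
  have hc : 0 < v p.leadingCoeff :=
    v.pos (leadingCoeff_ne_zero.mpr (by rintro rfl; simp at hpos))
  set c := v p.leadingCoeff
  set R := max 1 (2 * B / c)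
  refine ⟨p.natDegree * Real.posLog R + Real.posLog (2 / c), fun x => ?_⟩
  have hP := Real.posLog_nonneg (x := v (p.eval x))
  have hC := Real.posLog_nonneg (x := 2 / c)
  have hR := mul_nonneg (Nat.cast_nonneg (α := ℝ) p.natDegree) (Real.posLog_nonneg (x := R))
  rcases le_total (v x) R with hx | hx
  · have := mul_le_mul_of_nonneg_left (Real.posLog_le_posLog (v.nonneg x) hx)
      (Nat.cast_nonneg (α := ℝ) p.natDegree)
    linarith
  · have h1 : 1 ≤ v x := (le_max_left _ _).trans hx
    have h2 : 2 * B ≤ v x * c := (div_le_iff₀ hc).mp ((le_max_right _ _).trans hx)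
    have hlead : c * v x ^ (m + 1) ≤ v (p.eval x) + B * v x ^ m := by
      have hq := h x
      rw [max_eq_right h1] at hq
      have hsplit : p.leadingCoeff * x ^ (m + 1) = p.eval x - p.eraseLead.eval x := by
        rw [eq_sub_iff_add_eq', ← eval_monomial, ← eval_add, ← hm,
          eraseLead_add_monomial_natDegree_leadingCoeff]
      calc c * v x ^ (m + 1) = v (p.eval x - p.eraseLead.eval x) := by
            rw [← hsplit, v.map_mul, v.map_pow]
        _ ≤ v (p.eval x) + v (p.eraseLead.eval x) := v.sub_le_add _ _
        _ ≤ _ := by linarith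
    have hmul := mul_le_mul_of_nonneg_right h2 (pow_nonneg (v.nonneg x) m)
    have hpow : v x ^ (m + 1) ≤ 2 / c * v (p.eval x) := by
      rw [div_mul_eq_mul_div, le_div_iff₀ hc]
      rw [pow_succ] at hlead ⊢
      linarith
    have := (Real.posLog_le_posLog (pow_nonneg (v.nonneg x) _) hpow).trans Real.posLog_mul
    rw [Real.posLog_pow, ← hm] at this
    linarith

end Polynomial

theorem escape_rate_exists_and_comparable_to_logplus
    (K : Type*) [Field K] (v : AbsoluteValue K ℝ)
    (d e : ℕ) (he : 1 ≤ e) (hde : e < d)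
    (f g : Polynomial K) (hf : f.natDegree = d) (hg : g.natDegree = e) :
    ∃ κ : ℝ, 0 ≤ κ ∧
      ∀ x : ℕ → K, (∀ n : ℕ, g.eval (x (n + 1)) = f.eval (x n)) →
        ∃ G : ℝ,
          Tendsto (fun n : ℕ => ((e : ℝ) / (d : ℝ)) ^ n * Real.log (max 1 (v (x n))))
            atTop (nhds G) ∧
          |G - Real.log (max 1 (v (x 0)))| ≤ κ := by
  obtain ⟨C₁, h₁⟩ := f.exists_posLog_eval_le v
  obtain ⟨C₂, h₂⟩ := f.exists_le_posLog_eval v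
  obtain ⟨C₃, h₃⟩ := g.exists_posLog_eval_le v
  obtain ⟨C₄, h₄⟩ := g.exists_le_posLog_eval v
  rw [hf] at h₁ h₂
  rw [hg] at h₃ h₄
  have hd : (0 : ℝ) < d := by exact_mod_cast (by omega : 0 < d)
  have hr : (e : ℝ) / d < 1 := (div_lt_one hd).mpr (by exact_mod_cast hde)
  set C := max 0 (max (C₁ + C₄) (C₂ + C₃))
  have hC₁ : C₁ + C₄ ≤ C := (le_max_left _ _).trans (le_max_right _ _)
  have hC₂ : C₂ + C₃ ≤ C := (le_max_right _ _).trans (le_max_right _ _)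
  have hC₀ : 0 ≤ C := le_max_left _ _
  refine ⟨C / d / (1 - e / d), div_nonneg (by positivity) (by linarith), fun x hx => ?_⟩
  simp_rw [← Real.posLog_eq_log_max_one (v.nonneg _)]
  set a : ℕ → ℝ := fun n => ((e : ℝ) / d) ^ n * Real.posLog (v (x n)) with ha
  have hstep (n : ℕ) : dist (a n) (a (n + 1)) ≤ C / d * ((e : ℝ) / d) ^ n := by
    have hdiff : a n - a (n + 1) = ((d : ℝ) * Real.posLog (v (x n))
        - e * Real.posLog (v (x (n + 1)))) / d * ((e : ℝ) / d) ^ n := by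
      simp only [ha, pow_succ]
      field_simp
    rw [Real.dist_eq, hdiff, abs_mul, abs_div, abs_of_pos hd,
      abs_of_nonneg (by positivity : 0 ≤ ((e : ℝ) / d) ^ n)]
    gcongr
    have hf₁ := h₁ (x n)
    have hf₂ := h₂ (x n)
    have hg₁ := h₃ (x (n + 1))
    have hg₂ := h₄ (x (n + 1))
    rw [hx n] at hg₁ hg₂
    rw [abs_le]
    constructor <;> linarith
  obtain ⟨G, hG⟩ := cauchySeq_tendsto_of_complete (cauchySeq_of_le_geometric _ _ hr hstep)
  refine ⟨G, hG, ?_⟩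
  have := dist_le_of_le_geometric_of_tendsto₀ _ _ hr hstep hG
  rwa [dist_comm, Real.dist_eq, show a 0 = Real.posLog (v (x 0)) by simp [ha]] at this
end

section
/- Let p be a prime, let e be an integer with 1 ≤ e < p, and define polynomials f_n ∈ 𝔽_p[X] by f_1 = X and f_{n+1} = X^{p^n} − f_n^e. Let π ∈ 𝔽_p[X] be irreducible, and suppose r ≥ 1 is the least positive integer such that π divides f_r. Then for every n ≥ 1: (i) if r does not divide n, then π does not divide f_n; (ii) if n = r·k for a positive integer k, then the multiplicity of π as a factor of f_n equals e^{k−1} times the multiplicity of π as a factor of f_r. -/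
open Polynomial

/-- Shifting the index by `n` agrees with the `p ^ n`-th power up to a multiple of `f n ^ e`. The
cofactor stays prime to a prime divisor `π` of `f n` as long as the earlier terms do. -/
theorem exists_shift_eq_pow_add_mul (p : ℕ) [hp : Fact p.Prime] (e : ℕ) (he : 1 ≤ e) (hep : e < p)
    (f : ℕ → Polynomial (ZMod p)) (hf1 : f 1 = X)
    (hfrec : ∀ n : ℕ, 1 ≤ n → f (n + 1) = X ^ (p ^ n) - (f n) ^ e)
    (π : Polynomial (ZMod p)) (hπ : Prime π) (n : ℕ) (hn : 1 ≤ n) (hdvd : π ∣ f n)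
    (j : ℕ) (hj : 1 ≤ j) :
    ∃ u, f (n + j) = f j ^ p ^ n + f n ^ e * u ∧
      ((∀ i, 1 ≤ i → i < j → ¬ π ∣ f i) → ¬ π ∣ u) := by
  induction j, hj using Nat.le_induction with
  | base =>
    refine ⟨-1, by rw [hfrec n hn, hf1]; ring, fun _ h => hπ.not_isUnit ?_⟩
    exact isUnit_of_dvd_one ((dvd_neg (b := (1 : (ZMod p)[X]))).mp h)
  | succ j hj ih =>
    obtain ⟨u, hu, hnd⟩ := ih
    obtain ⟨q, hq⟩ := Polynomial.powAddExpansion (f j ^ p ^ n) (f n ^ e * u) e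
    refine ⟨-(u * ((e : (ZMod p)[X]) * (f j ^ p ^ n) ^ (e - 1) + q * (f n ^ e * u))), ?_, ?_⟩
    · rw [← add_assoc, hfrec (n + j) (by lia), hfrec j hj, sub_pow_char_pow, hu, hq,
        pow_right_comm (f j) e, ← pow_mul X, ← pow_add p, add_comm j n]
      ring
    · intro h hdiv
      rw [dvd_neg] at hdiv
      have hfn : π ∣ q * (f n ^ e * u) :=
        ((hdvd.trans (dvd_pow_self _ (by lia))).mul_right u).mul_left q
      rcases hπ.dvd_or_dvd hdiv with hu' | hdiv
      · exact hnd (fun i hi hij => h i hi (by lia)) hu'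
      · rcases hπ.dvd_or_dvd ((dvd_add_left hfn).mp hdiv) with he' | hfj
        · refine hπ.not_isUnit (isUnit_of_dvd_unit he' ?_)
          have hne : (e : ZMod p) ≠ 0 := fun h0 =>
            absurd (Nat.le_of_dvd he ((ZMod.natCast_eq_zero_iff e p).mp h0)) (by lia)
          simpa using (Polynomial.isUnit_C (R := ZMod p)).mpr hne.isUnit
        · exact h j hj (by lia) (hπ.dvd_of_dvd_pow (hπ.dvd_of_dvd_pow hfj))

theorem multiplicity_rigidity (p : ℕ) [hp : Fact p.Prime] (e : ℕ) (he : 1 ≤ e) (hep : e < p)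
    (f : ℕ → Polynomial (ZMod p))
    (hf1 : f 1 = X)
    (hfrec : ∀ n : ℕ, 1 ≤ n → f (n + 1) = X ^ (p ^ n) - (f n) ^ e)
    (π : Polynomial (ZMod p)) (hπ : Irreducible π)
    (r : ℕ) (hr : 1 ≤ r) (hdvd : π ∣ f r) (hleast : ∀ j : ℕ, 1 ≤ j → j < r → ¬ π ∣ f j) :
    ∀ n : ℕ, 1 ≤ n →
      ((¬ r ∣ n → ¬ π ∣ f n) ∧
        (∀ k : ℕ, 1 ≤ k → n = r * k →
          ∀ m : ℕ, π ^ m ∣ f r → ¬ π ^ (m + 1) ∣ f r →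
            π ^ (e ^ (k - 1) * m) ∣ f n ∧ ¬ π ^ (e ^ (k - 1) * m + 1) ∣ f n)) := by
  have hprime : Prime π := hπ.prime
  have shift := exists_shift_eq_pow_add_mul p e he hep f hf1 hfrec π hprime
  intro n hn
  constructor
  · induction n using Nat.strong_induction_on with
    | _ n ih =>
      intro hrn hdiv
      rcases lt_or_ge n r with hlt | hge
      · exact hleast n hn hlt hdiv
      obtain ⟨j, rfl⟩ := Nat.exists_eq_add_of_le hge
      have hrj : ¬ r ∣ j := fun h => hrn ((Nat.dvd_add_right dvd_rfl).mpr h)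
      have hj : 1 ≤ j := Nat.one_le_iff_ne_zero.mpr fun h => hrj (h ▸ dvd_zero r)
      obtain ⟨u, hu, -⟩ := shift r hr hdvd j hj
      rw [hu] at hdiv
      have hfr : π ∣ f r ^ e * u := (hdvd.trans (dvd_pow_self _ (by lia))).mul_right u
      exact ih j (by lia) hj hrj (hprime.dvd_of_dvd_pow ((dvd_add_left hfr).mp hdiv))
  · rintro k hk rfl m hm hm'
    have hm0 : 1 ≤ m := Nat.one_le_iff_ne_zero.mpr fun h => hm' (by simpa [h] using hdvd)
    obtain ⟨c, hc⟩ := hm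
    have factor : ∃ d, f (r * k) = π ^ (e ^ (k - 1) * m) * d ∧ ¬ π ∣ d := by
      clear hn
      induction k, hk using Nat.le_induction with
      | base =>
        refine ⟨c, by simpa using hc, fun h => hm' ?_⟩
        rw [hc, pow_succ]
        exact mul_dvd_mul_left _ h
      | succ k hk ih =>
        obtain ⟨d, hd, hπd⟩ := ih
        have hA : e ^ (k - 1) * m ≠ 0 := by positivity
        have hdk : π ∣ f (r * k) := hd ▸ (dvd_pow_self π hA).mul_right d
        obtain ⟨u, hu, hπu⟩ := shift (r * k) (Nat.mul_pos hr hk) hdk r hr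
        have hexp : e ^ (k - 1) * m * e = e ^ k * m := by
          obtain ⟨k, rfl⟩ := Nat.exists_eq_add_of_le' hk
          simp only [Nat.add_sub_cancel]
          ring
        have hlt : e ^ k * m < m * p ^ (r * k) := by
          rw [mul_comm]
          refine Nat.mul_lt_mul_of_pos_left ?_ hm0
          exact (Nat.pow_lt_pow_left hep (by lia)).trans_le
            (Nat.pow_le_pow_right hp.out.pos (Nat.le_mul_of_pos_left k hr))
        obtain ⟨t, ht⟩ := Nat.exists_eq_add_of_lt hlt
        refine ⟨π * (π ^ t * c ^ p ^ (r * k)) + d ^ e * u, ?_, fun h => ?_⟩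
        · rw [Nat.mul_succ, hu, hc, hd, mul_pow, mul_pow, ← pow_mul, ← pow_mul, hexp, ht,
            Nat.add_sub_cancel]
          ring
        · rcases hprime.dvd_or_dvd ((dvd_add_right (dvd_mul_right π _)).mp h) with h | h
          · exact hπd (hprime.dvd_of_dvd_pow h)
          · exact hπu hleast h
    obtain ⟨d, hd, hπd⟩ := factor
    rw [hd, pow_succ]
    exact ⟨dvd_mul_right _ _,
      fun h => hπd ((mul_dvd_mul_iff_left (pow_ne_zero _ hπ.ne_zero)).mp h)⟩
end

section
/- Let p be a prime, let e be an integer with 1 ≤ e < p, and define polynomials f_n ∈ 𝔽_p[X] by f_1 = X and f_{n+1} = X^{p^n} − f_n^e. Then for all sufficiently large n, the polynomial f_n has a primitive prime factor: there exists an irreducible π ∈ 𝔽_p[X] such that π divides f_n but π does not divide f_j for any 1 ≤ j < n. -/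
open Polynomial

namespace PrimitivePrimeFactor

/-- `f` satisfies `f 1 = X` and `f (n + 1) = X ^ p ^ n - f n ^ e` over `ZMod p`. -/
def IsRecSeq (p e : ℕ) (f : ℕ → Polynomial (ZMod p)) : Prop :=
  f 1 = X ∧ ∀ n : ℕ, 1 ≤ n → f (n + 1) = X ^ (p ^ n) - (f n) ^ e

variable {p e : ℕ} [hp : Fact p.Prime] {f : ℕ → Polynomial (ZMod p)}

theorem IsRecSeq.natDegree (hf : IsRecSeq p e f) (hep : e < p) {n : ℕ} (hn : 1 ≤ n) :
    (f n).natDegree = p ^ (n - 1) := by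
  induction n, hn using Nat.le_induction with
  | base => simp [hf.1]
  | succ n hn ih =>
    have hlt : ((f n) ^ e).natDegree < (X ^ (p ^ n) : Polynomial (ZMod p)).natDegree := by
      rw [natDegree_X_pow, natDegree_pow, ih]
      calc e * p ^ (n - 1) < p * p ^ (n - 1) :=
            Nat.mul_lt_mul_of_pos_right hep (pow_pos hp.out.pos _)
        _ = p ^ n := by rw [← pow_succ', Nat.sub_add_cancel hn]
    rw [hf.2 n hn, natDegree_sub_eq_left_of_natDegree_lt hlt, natDegree_X_pow, Nat.add_sub_cancel]

theorem IsRecSeq.ne_zero (hf : IsRecSeq p e f) (hep : e < p) {n : ℕ} (hn : 1 ≤ n) :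
    f n ≠ 0 := by
  intro h
  have h1 := hf.natDegree hep hn
  rw [h, natDegree_zero] at h1
  exact (pow_pos hp.out.pos (n - 1)).ne h1

theorem IsRecSeq.dvd_sub_pow (hf : IsRecSeq p e f) (he : 1 ≤ e) {r k : ℕ} (hr : 1 ≤ r)
    (hk : 1 ≤ k) : f r ∣ f (r + k) - f k ^ p ^ r := by
  induction k, hk using Nat.le_induction with
  | base =>
    rw [hf.2 r hr, hf.1, sub_sub_cancel_left, dvd_neg]
    exact dvd_pow_self _ (by lia)
  | succ k hk ih =>
    have h : f (r + (k + 1)) - f (k + 1) ^ p ^ r = -(f (r + k) ^ e - (f k ^ p ^ r) ^ e) := by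
      rw [← add_assoc, hf.2 (r + k) (by lia), hf.2 k hk, sub_pow_char_pow, ← pow_mul, ← pow_mul,
        ← pow_mul, ← pow_add, add_comm k r, mul_comm e]
      ring
    rw [h, dvd_neg]
    exact ih.trans (sub_dvd_pow_sub_pow _ _ _)

theorem IsRecSeq.dvd_add_iff (hf : IsRecSeq p e f) (he : 1 ≤ e) {π : Polynomial (ZMod p)}
    (hπ : Prime π) {r k : ℕ} (hr : 1 ≤ r) (hk : 1 ≤ k) (hdvd : π ∣ f r) :
    π ∣ f (r + k) ↔ π ∣ f k := by
  have h := hdvd.trans (hf.dvd_sub_pow he hr hk)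
  have hpr : p ^ r ≠ 0 := pow_ne_zero r hp.out.ne_zero
  rw [dvd_iff_dvd_of_dvd_sub h, hπ.dvd_pow_iff_dvd hpr]

/-- The indices of the terms divisible by `π` are multiples of the first such index. -/
theorem IsRecSeq.rank_dvd (hf : IsRecSeq p e f) (he : 1 ≤ e) {π : Polynomial (ZMod p)}
    (hπ : Prime π) {r : ℕ} (hr : 1 ≤ r) (hdvd : π ∣ f r)
    (hmin : ∀ j, 1 ≤ j → j < r → ¬ π ∣ f j) {n : ℕ} (hn : 1 ≤ n) (h : π ∣ f n) : r ∣ n := by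
  induction n using Nat.strong_induction_on with
  | _ n ih =>
    rcases lt_trichotomy n r with hlt | rfl | hgt
    · exact absurd h (hmin n hn hlt)
    · exact dvd_rfl
    · obtain ⟨k, rfl⟩ := Nat.exists_eq_add_of_lt hgt
      rw [add_assoc] at h ⊢
      exact (Nat.dvd_add_right dvd_rfl).2
        (ih (k + 1) (by lia) (by lia) ((hf.dvd_add_iff he hπ hr (by lia) hdvd).1 h))

theorem IsRecSeq.derivative_succ (hf : IsRecSeq p e f) {n : ℕ} (hn : 1 ≤ n) :
    derivative (f (n + 1)) = C (-(e : ZMod p)) * (f n ^ (e - 1) * derivative (f n)) := by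
  rw [hf.2 n hn, derivative_sub, derivative_X_pow, derivative_pow]
  have : ((p ^ n : ℕ) : ZMod p) = 0 := by
    rw [Nat.cast_pow, CharP.cast_eq_zero, zero_pow (by lia)]
  rw [this]
  simp [mul_assoc]

theorem natCast_ne_zero (he : 1 ≤ e) (hep : e < p) : (e : ZMod p) ≠ 0 := by
  rw [Ne, ZMod.natCast_eq_zero_iff]
  exact Nat.not_dvd_of_pos_of_lt he hep

theorem IsRecSeq.derivative_ne_zero (hf : IsRecSeq p e f) (he : 1 ≤ e) (hep : e < p) {n : ℕ}
    (hn : 1 ≤ n) : derivative (f n) ≠ 0 := by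
  induction n, hn using Nat.le_induction with
  | base => simp [hf.1]
  | succ n hn ih =>
    rw [hf.derivative_succ hn]
    exact mul_ne_zero (C_ne_zero.2 (neg_ne_zero.2 (natCast_ne_zero he hep)))
      (mul_ne_zero (pow_ne_zero _ (hf.ne_zero hep hn)) ih)

theorem multiplicity_le_multiplicity_derivative {π g : Polynomial (ZMod p)} (hπ : Prime π)
    (hg : derivative g ≠ 0) : multiplicity π g ≤ multiplicity π (derivative g) + 1 := by
  have h := pow_sub_one_dvd_derivative_of_pow_dvd (pow_multiplicity_dvd π g)
  have := (FiniteMultiplicity.of_not_isUnit hπ.not_isUnit hg).pow_dvd_iff_le_multiplicity.1 h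
  lia

theorem IsRecSeq.multiplicity_derivative_succ (hf : IsRecSeq p e f) (he : 1 ≤ e) (hep : e < p)
    {π : Polynomial (ZMod p)} (hπ : Prime π) {n : ℕ} (hn : 1 ≤ n) :
    multiplicity π (derivative (f (n + 1))) =
      (e - 1) * multiplicity π (f n) + multiplicity π (derivative (f n)) := by
  have h0 := hf.derivative_ne_zero he hep (n := n + 1) (by lia)
  have hfin : ∀ g : Polynomial (ZMod p), g ≠ 0 → FiniteMultiplicity π g := fun g hg ↦
    FiniteMultiplicity.of_not_isUnit hπ.not_isUnit hg
  have hC : multiplicity π (C (-(e : ZMod p))) = 0 :=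
    multiplicity_of_isUnit_right hπ.not_isUnit
      (isUnit_C.2 (neg_ne_zero.2 (natCast_ne_zero he hep)).isUnit)
  rw [hf.derivative_succ hn] at h0 ⊢
  rw [multiplicity_mul hπ (hfin _ h0), multiplicity_mul hπ (hfin _ (right_ne_zero_of_mul h0)),
    (hfin _ (hf.ne_zero hep hn)).multiplicity_pow hπ, hC, zero_add]

theorem IsRecSeq.multiplicity_derivative_lt (hf : IsRecSeq p e f) (he : 1 ≤ e) (hep : e < p)
    {π : Polynomial (ZMod p)} (hπ : Prime π) {r : ℕ} (hr : 1 ≤ r) (hdvd : π ∣ f r)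
    (hmin : ∀ j, 1 ≤ j → j < r → ¬ π ∣ f j) {n : ℕ} (hn : 1 ≤ n) :
    multiplicity π (derivative (f n)) + 1 ≤ e ^ ((n - 1) / r) := by
  induction n, hn using Nat.le_induction with
  | base =>
    simp [hf.1, multiplicity_of_isUnit_right hπ.not_isUnit isUnit_one]
  | succ n hn ih =>
    rw [hf.multiplicity_derivative_succ he hep hπ hn]
    obtain ⟨m, rfl⟩ := Nat.exists_eq_add_of_le' hn
    simp only [Nat.add_sub_cancel] at ih ⊢
    by_cases h : π ∣ f (m + 1)
    · have hle := multiplicity_le_multiplicity_derivative hπ (hf.derivative_ne_zero he hep hn)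
      rw [Nat.succ_div_of_dvd (hf.rank_dvd he hπ hr hdvd hmin hn h), pow_succ]
      obtain ⟨d, rfl⟩ := Nat.exists_eq_add_of_le' he
      rw [Nat.add_sub_cancel]
      nlinarith
    · rw [multiplicity_eq_zero.2 h, mul_zero, zero_add]
      exact ih.trans (Nat.pow_le_pow_right he (Nat.div_le_div_right (Nat.le_succ m)))

theorem IsRecSeq.dvd_prod (hf : IsRecSeq p e f) (he : 1 ≤ e) (hep : e < p) {n : ℕ} (hn : 1 ≤ n)
    (h : ∀ π, Irreducible π → π ∣ f n → ∃ j, 1 ≤ j ∧ j < n ∧ π ∣ f j) :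
    f n ∣ ∏ r ∈ n.properDivisors, f r ^ e ^ ((n - 1) / r) := by
  rw [UniqueFactorizationMonoid.dvd_iff_emultiplicity_le (hf.ne_zero hep hn)]
  intro π hπ
  by_cases hd : π ∣ f n
  · classical
    have hex := h π hπ.irreducible hd
    have hr := Nat.find_spec hex
    have hmin : ∀ j, 1 ≤ j → j < Nat.find hex → ¬ π ∣ f j := fun j hj hlt hdj ↦
      Nat.find_min hex hlt ⟨hj, hlt.trans hr.2.1, hdj⟩
    set r := Nat.find hex
    have hrn := hf.rank_dvd he hπ hr.1 hr.2.2 hmin hn hd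
    have hle := (multiplicity_le_multiplicity_derivative hπ
      (hf.derivative_ne_zero he hep hn)).trans
      (hf.multiplicity_derivative_lt he hep hπ hr.1 hr.2.2 hmin hn)
    rw [(FiniteMultiplicity.of_not_isUnit hπ.not_isUnit
      (hf.ne_zero hep hn)).emultiplicity_eq_multiplicity]
    refine (Nat.cast_le.2 hle).trans (le_emultiplicity_of_pow_dvd ?_)
    exact (pow_dvd_pow_of_dvd hr.2.2 _).trans
      (Finset.dvd_prod_of_mem (fun r ↦ f r ^ e ^ ((n - 1) / r))
        (Nat.mem_properDivisors.2 ⟨hrn, hr.2.1⟩))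
  · rw [emultiplicity_eq_zero.2 hd]
    exact zero_le

theorem IsRecSeq.pow_le_sum (hf : IsRecSeq p e f) (he : 1 ≤ e) (hep : e < p) {n : ℕ} (hn : 1 ≤ n)
    (h : ∀ π, Irreducible π → π ∣ f n → ∃ j, 1 ≤ j ∧ j < n ∧ π ∣ f j) :
    p ^ (n - 1) ≤ ∑ r ∈ n.properDivisors, e ^ ((n - 1) / r) * p ^ (r - 1) := by
  have hpos : ∀ r ∈ n.properDivisors, 1 ≤ r := fun r hr ↦ Nat.pos_of_mem_properDivisors hr
  have h0 : ∀ r ∈ n.properDivisors, f r ^ e ^ ((n - 1) / r) ≠ 0 := fun r hr ↦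
    pow_ne_zero _ (hf.ne_zero hep (hpos r hr))
  have hle := natDegree_le_of_dvd (hf.dvd_prod he hep hn h) (Finset.prod_ne_zero_iff.2 h0)
  rw [natDegree_prod _ _ h0, hf.natDegree hep hn] at hle
  refine hle.trans (Finset.sum_le_sum fun r hr ↦ ?_)
  rw [natDegree_pow, hf.natDegree hep (hpos r hr)]

theorem pow_mul_pow_le (hep : e < p) {n r : ℕ} (hr : r ∈ n.properDivisors) (hr1 : r ≠ 1) :
    e ^ ((n - 1) / r) * p ^ (r - 1) ≤ p ^ (n / 2) := by
  obtain ⟨⟨s, rfl⟩, hlt⟩ := Nat.mem_properDivisors.1 hr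
  have hr0 := Nat.pos_of_mem_properDivisors hr
  have hs : 2 ≤ s := by
    by_contra! hs
    interval_cases s <;> lia
  have hdiv : (r * s - 1) / r < s := (Nat.div_lt_iff_lt_mul hr0).2 (by
    rw [mul_comm s]; lia)
  have hexp : (r * s - 1) / r + (r - 1) ≤ r * s / 2 := by
    rw [Nat.le_div_iff_mul_le two_pos]
    obtain ⟨a, rfl⟩ := Nat.exists_eq_add_of_le hs
    obtain ⟨b, rfl⟩ := Nat.exists_eq_add_of_le (show 2 ≤ r by lia)
    have : (2 + b) * (2 + a) = 4 + 2 * a + 2 * b + a * b := by ring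
    have := Nat.zero_le (a * b)
    lia
  calc _ ≤ p ^ ((r * s - 1) / r) * p ^ (r - 1) :=
        Nat.mul_le_mul_right _ (Nat.pow_le_pow_left hep.le _)
    _ = p ^ ((r * s - 1) / r + (r - 1)) := (pow_add _ _ _).symm
    _ ≤ _ := Nat.pow_le_pow_right hp.out.pos hexp

theorem lt_two_pow_half_sub_two {n : ℕ} (hn : 20 ≤ n) : n < 2 ^ (n - 2 - n / 2) := by
  have key : ∀ k : ℕ, 10 ≤ k → 2 * k + 1 < 2 ^ (k - 2) := by
    intro k hk
    induction k, hk using Nat.le_induction with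
    | base => norm_num
    | succ k hk ih =>
      rw [show k + 1 - 2 = (k - 2) + 1 by lia, pow_succ]
      lia
  calc n ≤ 2 * (n / 2) + 1 := by lia
    _ < 2 ^ (n / 2 - 2) := key _ (by lia)
    _ ≤ _ := Nat.pow_le_pow_right two_pos (by lia)

theorem sum_properDivisors_lt (hep : e < p) {n : ℕ} (hn : 20 ≤ n) :
    ∑ r ∈ n.properDivisors, e ^ ((n - 1) / r) * p ^ (r - 1) < p ^ (n - 1) := by
  have hsum : ∑ r ∈ n.properDivisors.erase 1, e ^ ((n - 1) / r) * p ^ (r - 1) ≤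
      n * p ^ (n / 2) := by
    refine (Finset.sum_le_card_nsmul _ _ (p ^ (n / 2)) fun r hr ↦
      pow_mul_pow_le hep (Finset.mem_of_mem_erase hr) (Finset.ne_of_mem_erase hr)).trans ?_
    rw [smul_eq_mul]
    refine Nat.mul_le_mul_right _ ?_
    calc (n.properDivisors.erase 1).card ≤ (Finset.Ico 1 n).card :=
          Finset.card_le_card ((Finset.erase_subset _ _).trans (Finset.filter_subset _ _))
      _ ≤ n := by simp
  have hn2 : n * p ^ (n / 2) < p ^ (n - 2) := by
    calc n * p ^ (n / 2) < p ^ (n - 2 - n / 2) * p ^ (n / 2) :=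
          Nat.mul_lt_mul_of_pos_right ((lt_two_pow_half_sub_two hn).trans_le
            (Nat.pow_le_pow_left hp.out.two_le _)) (pow_pos hp.out.pos _)
      _ = p ^ (n - 2) := by rw [← pow_add]; congr 1; lia
  have he1 : e ^ (n - 1) + p ^ (n - 2) ≤ p ^ (n - 1) := by
    rw [show n - 1 = (n - 2) + 1 by lia, pow_succ, pow_succ]
    calc e ^ (n - 2) * e + p ^ (n - 2) ≤ p ^ (n - 2) * e + p ^ (n - 2) := by gcongr
      _ = p ^ (n - 2) * (e + 1) := by ring
      _ ≤ _ := Nat.mul_le_mul_left _ hep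
  rw [← Finset.add_sum_erase _ _ (Nat.one_mem_properDivisors_iff_one_lt.2 (by lia : 1 < n)),
    Nat.div_one, Nat.sub_self, pow_zero, mul_one]
  lia

end PrimitivePrimeFactor

theorem eventually_primitive_prime_factor (p : ℕ) [hp : Fact p.Prime] (e : ℕ)
    (he : 1 ≤ e) (hep : e < p)
    (f : ℕ → Polynomial (ZMod p))
    (hf1 : f 1 = X)
    (hfrec : ∀ n : ℕ, 1 ≤ n → f (n + 1) = X ^ (p ^ n) - (f n) ^ e) :
    ∃ N : ℕ, ∀ n : ℕ, N ≤ n →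
      ∃ π : Polynomial (ZMod p), Irreducible π ∧ π ∣ f n ∧
        ∀ j : ℕ, 1 ≤ j → j < n → ¬ π ∣ f j := by
  refine ⟨20, fun n hn ↦ ?_⟩
  by_contra! h
  have hf : PrimitivePrimeFactor.IsRecSeq p e f := ⟨hf1, hfrec⟩
  exact (PrimitivePrimeFactor.sum_properDivisors_lt hep hn).not_ge
    (hf.pow_le_sum he hep (by lia) h)
end

section
/- Let K be a field equipped with a nonarchimedean absolute value |·|, let d > e ≥ 1 be integers and let c ∈ K. If there exists a preperiodic path for the correspondence y^e = x^d + c starting at 0 (that is, a sequence x : ℕ → K with x_0 = 0, x_{n+1}^e = x_n^d + c for all n ≥ 0, and x_{m+k} = x_{n+k} for all k ≥ 0 for some m < n), then |c| ≤ 1. -/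
/-- For a nonarchimedean absolute value, adding a strictly smaller element does not decrease
the absolute value. -/
theorem AbsoluteValue.le_add_of_lt_of_nonarchimedean {K : Type*} [Field K]
    (v : AbsoluteValue K ℝ) (hna : ∀ u w : K, v (u + w) ≤ max (v u) (v w))
    {a c : K} (h : v c < v a) : v a ≤ v (a + c) := by
  have h1 := hna (a + c) (-c)
  rw [add_neg_cancel_right, v.map_neg] at h1
  exact (le_max_iff.mp h1).resolve_right h.not_ge

/-- Beyond the escape radius, a step of the correspondence strictly increases the absolute
value. -/
theorem AbsoluteValue.lt_of_pow_eq_pow_add {K : Type*} [Field K]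
    (v : AbsoluteValue K ℝ) (hna : ∀ u w : K, v (u + w) ≤ max (v u) (v w))
    {d e : ℕ} (hde : e < d) {a b c : K} (hc : 1 < v c) (hac : v c < v a ^ d)
    (hab : b ^ e = a ^ d + c) : v a < v b := by
  have ha : 1 < v a := lt_of_pow_lt_pow_left₀ d (v.nonneg a) (by simpa using hc.trans hac)
  have hle : v a ^ d ≤ v b ^ e := by
    rw [← map_pow, ← map_pow, hab]
    exact v.le_add_of_lt_of_nonarchimedean hna (by rwa [map_pow])
  exact lt_of_pow_lt_pow_left₀ e (v.nonneg b) ((pow_lt_pow_right₀ ha hde).trans_le hle)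

theorem unicritical_PCC_height_bound_nonarchimedean
    (K : Type*) [Field K] (v : AbsoluteValue K ℝ)
    (hna : ∀ u w : K, v (u + w) ≤ max (v u) (v w))
    (d e : ℕ) (he : 1 ≤ e) (hde : e < d)
    (c : K) (x : ℕ → K) (h0 : x 0 = 0)
    (hpath : ∀ n : ℕ, x (n + 1) ^ e = x n ^ d + c)
    (hpre : ∃ m n : ℕ, m < n ∧ ∀ k : ℕ, x (m + k) = x (n + k)) :
    v c ≤ 1 := by
  by_contra! hc
  have hescape : ∀ n, v c < v (x (n + 1)) ^ d := by
    intro n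
    induction n with
    | zero =>
      have h1 : v (x 1) ^ e = v c := by
        rw [← map_pow, hpath 0, h0, zero_pow (by lia), zero_add]
      have hx : 1 < v (x 1) := lt_of_pow_lt_pow_left₀ e (v.nonneg _) (by simpa [h1] using hc)
      simpa [h1] using pow_lt_pow_right₀ hx hde
    | succ n ih =>
      exact ih.trans (pow_lt_pow_left₀ (v.lt_of_pow_eq_pow_add hna hde hc ih (hpath _))
        (v.nonneg _) (by lia))
  have hmono : StrictMono fun n => v (x (n + 1)) :=
    strictMono_nat_of_lt_succ fun n =>
      v.lt_of_pow_eq_pow_add hna hde hc (hescape n) (hpath _)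
  obtain ⟨m, n, hmn, h⟩ := hpre
  exact (hmono hmn).ne (congrArg v (h 1))
end
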